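/- arXiv:2506.13451 — 6 statements merged into one kernel-verified Lean document; each statement's English description precedes it below -/
import Mathlib

section
/- Let k ≥ 2 and r ≥ 2 be integers and let Q_1, …, Q_r be pairwise disjoint sets in a real inner product space, each of size k, and let D = diam(Q_1, …, Q_r) be the maximum distance between points of distinct sets. Then there exist a partition {P_1, …, P_k} of the union Q_1 ∪ ⋯ ∪ Q_r with |P_i ∩ Q_j| = 1 for all i ∈ {1,…,k}, j ∈ {1,…,r}, and a point c such that for every i the closed ball of radius D/√(2r) centered at c intersects the convex hull of P_i. -/
open scoped InnerProductSpace in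
/-- A weighted Chebyshev-type inequality for oppositely ordered families of vectors. -/
theorem sum_mul_inner_le_inner_sum_smul {ι E : Type*} [Fintype ι] [NormedAddCommGroup E]
    [InnerProductSpace ℝ E] (w : ι → ℝ) (hw : ∀ i, 0 ≤ w i) (hw1 : ∑ i, w i = 1) (a y : ι → E)
    (h : ∀ i i', 0 ≤ ⟪a i - a i', y i' - y i⟫_ℝ) :
    ∑ i, w i * ⟪a i, y i⟫_ℝ ≤ ⟪∑ i, w i • a i, ∑ i, w i • y i⟫_ℝ := by
  have h0 : 0 ≤ ∑ i, ∑ i', w i * w i' * ⟪a i - a i', y i' - y i⟫_ℝ :=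
    Finset.sum_nonneg fun i _ => Finset.sum_nonneg fun i' _ =>
      mul_nonneg (mul_nonneg (hw i) (hw i')) (h i i')
  have h1 : ⟪∑ i, w i • a i, ∑ i, w i • y i⟫_ℝ = ∑ i, ∑ i', w i * w i' * ⟪a i, y i'⟫_ℝ := by
    simp only [sum_inner, inner_sum, real_inner_smul_left, real_inner_smul_right, mul_assoc]
    rw [Finset.sum_comm]
    refine Finset.sum_congr rfl fun i _ => Finset.sum_congr rfl fun i' _ => by ring
  have h2 : ∑ i, ∑ i', w i * w i' * ⟪a i', y i⟫_ℝ = ∑ i, ∑ i', w i * w i' * ⟪a i, y i'⟫_ℝ := by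
    rw [Finset.sum_comm]
    refine Finset.sum_congr rfl fun i _ => Finset.sum_congr rfl fun i' _ => by ring
  have h3 : ∑ i, ∑ i', w i * w i' * ⟪a i, y i⟫_ℝ = ∑ i, w i * ⟪a i, y i⟫_ℝ := by
    refine Finset.sum_congr rfl fun i _ => ?_
    rw [← Finset.sum_mul, ← Finset.mul_sum, hw1, mul_one]
  have h4 : ∑ i, ∑ i', w i * w i' * ⟪a i', y i'⟫_ℝ = ∑ i, w i * ⟪a i, y i⟫_ℝ := by
    rw [Finset.sum_comm, ← h3]
    refine Finset.sum_congr rfl fun i _ => Finset.sum_congr rfl fun i' _ => by ring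
  have h5 : ∑ i, ∑ i', w i * w i' * ⟪a i - a i', y i' - y i⟫_ℝ
      = ∑ i, ∑ i', w i * w i' * ⟪a i, y i'⟫_ℝ - ∑ i, ∑ i', w i * w i' * ⟪a i, y i⟫_ℝ
        - ∑ i, ∑ i', w i * w i' * ⟪a i', y i'⟫_ℝ + ∑ i, ∑ i', w i * w i' * ⟪a i', y i⟫_ℝ := by
    simp only [← Finset.sum_add_distrib, ← Finset.sum_sub_distrib]
    refine Finset.sum_congr rfl fun i _ => Finset.sum_congr rfl fun i' _ => ?_
    simp only [inner_sub_left, inner_sub_right]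
    ring
  rw [h2, h3, h4] at h5
  linarith

open scoped InnerProductSpace in
theorem sum_sum_norm_sub_sq {ι E : Type*} [Fintype ι] [NormedAddCommGroup E]
    [InnerProductSpace ℝ E] (y : ι → E) :
    ∑ i, ∑ i', ‖y i - y i'‖ ^ 2
      = 2 * ((Fintype.card ι : ℝ) * ∑ i, ‖y i‖ ^ 2 - ‖∑ i, y i‖ ^ 2) := by
  have h : ‖∑ i, y i‖ ^ 2 = ∑ i, ∑ i', ⟪y i, y i'⟫_ℝ := by
    rw [← real_inner_self_eq_norm_sq]
    simp only [sum_inner, inner_sum]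
    exact Finset.sum_comm
  simp only [h, norm_sub_sq_real, Finset.sum_add_distrib, Finset.sum_sub_distrib,
    Finset.sum_const, Finset.card_univ, nsmul_eq_mul, ← Finset.mul_sum]
  ring

open scoped InnerProductSpace in
/-- If no convex combination separates them, finitely many balls, written as
`{c | A i - 2 ⟪m i, c⟫ + ‖c‖ ^ 2 ≤ 0}`, have a common point. -/
theorem exists_common_point_of_forall_stdSimplex {ι E : Type*} [Fintype ι] [Nonempty ι]
    [NormedAddCommGroup E] [InnerProductSpace ℝ E] (m : ι → E) (A : ι → ℝ)
    (h : ∀ w ∈ stdSimplex ℝ ι, ∑ i, w i * A i ≤ ‖∑ i, w i • m i‖ ^ 2) :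
    ∃ c : E, ∀ i, A i - 2 * ⟪m i, c⟫_ℝ + ‖c‖ ^ 2 ≤ 0 := by
  classical
  obtain ⟨w, hw, hmax⟩ := (isCompact_stdSimplex ℝ ι).exists_isMaxOn
    (⟨_, single_mem_stdSimplex ℝ (Classical.arbitrary ι)⟩ : (stdSimplex ℝ ι).Nonempty)
    (f := fun w => ∑ i, w i * A i - ‖∑ i, w i • m i‖ ^ 2)
    (Continuous.continuousOn (by fun_prop))
  refine ⟨∑ i, w i • m i, fun j => ?_⟩
  set c := ∑ i, w i • m i with hc
  set a := ∑ i, w i * A i with ha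
  have hac : a ≤ ‖c‖ ^ 2 := h w hw
  have key : ∀ t : ℝ, 0 < t → t ≤ 1 →
      A j - a - 2 * ⟪c, m j - c⟫_ℝ ≤ t * ‖m j - c‖ ^ 2 := by
    intro t ht ht1
    have hmem := convex_stdSimplex ℝ ι hw (single_mem_stdSimplex ℝ j)
      (sub_nonneg.2 ht1) ht.le (sub_add_cancel 1 t)
    have hle := hmax hmem
    have e1 : ∑ i, ((1 - t) • w + t • (Pi.single j 1 : ι → ℝ)) i * A i = (1 - t) * a + t * A j := by
      simp [add_mul, Finset.sum_add_distrib, ha, Finset.mul_sum, mul_assoc, Pi.single_apply]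
    have e2 : ∑ i, ((1 - t) • w + t • (Pi.single j 1 : ι → ℝ)) i • m i = c + t • (m j - c) := by
      have : ∑ i, ((1 - t) • w + t • (Pi.single j 1 : ι → ℝ)) i • m i = (1 - t) • c + t • m j := by
        simp [add_smul, Finset.sum_add_distrib, hc, Finset.smul_sum, mul_smul, Pi.single_apply]
      rw [this]
      module
    simp only [Set.mem_ofPred_eq] at hle
    rw [e1, e2, norm_add_sq_real, norm_smul, real_inner_smul_right, mul_pow, Real.norm_eq_abs,
      sq_abs] at hle
    have : t * (A j - a - 2 * ⟪c, m j - c⟫_ℝ) ≤ t * (t * ‖m j - c‖ ^ 2) := by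
      linarith
    exact le_of_mul_le_mul_left this ht
  have hlim : A j - a - 2 * ⟪c, m j - c⟫_ℝ ≤ 0 := by
    refine le_of_forall_pos_le_add fun ε hε => ?_
    have hpos : 0 < ‖m j - c‖ ^ 2 + 1 := by positivity
    have ht : 0 < min 1 (ε / (‖m j - c‖ ^ 2 + 1)) := lt_min one_pos (by positivity)
    refine (key _ ht (min_le_left _ _)).trans ?_
    calc _ ≤ ε / (‖m j - c‖ ^ 2 + 1) * (‖m j - c‖ ^ 2 + 1) := by
          gcongr
          · exact min_le_right _ _
          · linarith
      _ = 0 + ε := by field_simp; ring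
  rw [inner_sub_right, real_inner_self_eq_norm_sq, real_inner_comm] at hlim
  linarith

open scoped InnerProductSpace in
/-- There is a transversal rearrangement of `q` in which no exchange of two points of the same
colour decreases the sum of the squared norms of the part sums. -/
theorem exists_perm_forall_swap_inner_nonneg {ι κ E : Type*} [Fintype ι] [Fintype κ]
    [NormedAddCommGroup E] [InnerProductSpace ℝ E] (q : κ → ι → E) :
    ∃ σ : κ → Equiv.Perm ι, ∀ i i' j,
      0 ≤ ⟪(∑ l, q l (σ l i) - q j (σ j i)) - (∑ l, q l (σ l i') - q j (σ j i')),
        q j (σ j i') - q j (σ j i)⟫_ℝ := by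
  classical
  obtain ⟨σ, hσ⟩ := Finite.exists_min fun σ : κ → Equiv.Perm ι => ∑ i, ‖∑ l, q l (σ l i)‖ ^ 2
  refine ⟨σ, fun i i' j => ?_⟩
  rcases eq_or_ne i i' with rfl | hne
  · simp
  set d := q j (σ j i') - q j (σ j i) with hd
  set τ := Function.update σ j (Equiv.swap i i' |>.trans (σ j)) with hτ
  have hsum : ∀ n, ∑ l, q l (τ l n)
      = ∑ l, q l (σ l n) + (q j (σ j (Equiv.swap i i' n)) - q j (σ j n)) := by
    intro n
    rw [← sub_eq_iff_eq_add', ← Finset.sum_sub_distrib, Finset.sum_eq_single j]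
    · simp [hτ]
    · intro l _ hl
      simp [hτ, hl]
    · simp
  have hi : ∑ l, q l (τ l i) = ∑ l, q l (σ l i) + d := by rw [hsum, Equiv.swap_apply_left]
  have hi' : ∑ l, q l (τ l i') = ∑ l, q l (σ l i') - d := by
    rw [hsum, Equiv.swap_apply_right, hd]
    abel
  have hle : 0 ≤ ∑ n, (‖∑ l, q l (τ l n)‖ ^ 2 - ‖∑ l, q l (σ l n)‖ ^ 2) := by
    rw [Finset.sum_sub_distrib]
    exact sub_nonneg.2 (hσ τ)
  rw [← Finset.sum_subset (Finset.subset_univ {i, i'}), Finset.sum_pair hne, hi, hi',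
    norm_add_sq_real, norm_sub_sq_real _ d] at hle
  · have hrw : (∑ l, q l (σ l i) - q j (σ j i)) - (∑ l, q l (σ l i') - q j (σ j i'))
        = ∑ l, q l (σ l i) - ∑ l, q l (σ l i') + d := by
      rw [hd]
      abel
    rw [hrw, inner_add_left, inner_sub_left, real_inner_self_eq_norm_sq]
    linarith
  · intro n _ hn
    simp only [Finset.mem_insert, Finset.mem_singleton, not_or] at hn
    rw [hsum, Equiv.swap_apply_of_ne_of_ne hn.1 hn.2, sub_self, add_zero, sub_self]

open scoped InnerProductSpace in
/-- If no exchange within a colour decreases the sum of the squared norms of the part sums, then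
the balls `{c | ‖∑ j, (x i j - c)‖ ^ 2 ≤ ∑ j, ‖x i j - c‖ ^ 2}` have a common point. -/
theorem exists_norm_sum_sub_sq_le {ι κ E : Type*} [Fintype ι] [Nonempty ι] [Fintype κ]
    [Nontrivial κ] [NormedAddCommGroup E] [InnerProductSpace ℝ E] (x : ι → κ → E)
    (h : ∀ i i' j, 0 ≤ ⟪(∑ l, x i l - x i j) - (∑ l, x i' l - x i' j), x i' j - x i j⟫_ℝ) :
    ∃ c : E, ∀ i, ‖∑ j, (x i j - c)‖ ^ 2 ≤ ∑ j, ‖x i j - c‖ ^ 2 := by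
  set r : ℝ := (Fintype.card κ : ℝ) with hr
  have hr1 : 1 < r := Nat.one_lt_cast.2 Fintype.one_lt_card
  have hr0 : 0 < r := by linarith
  have hr2 : 0 < r - 1 := by linarith
  set s : ι → E := fun i => ∑ l, x i l with hs
  obtain ⟨c, hc⟩ := exists_common_point_of_forall_stdSimplex (fun i => r⁻¹ • s i)
    (fun i => (‖s i‖ ^ 2 - ∑ j, ‖x i j‖ ^ 2) / (r * (r - 1))) (by
      intro w hw
      set X : κ → E := fun j => ∑ i, w i • x i j with hX
      have hS : ∑ i, w i • s i = ∑ j, X j := by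
        simp only [hs, hX, Finset.smul_sum]
        exact Finset.sum_comm
      have hj : ∀ j, ∑ i, w i * ⟪s i - x i j, x i j⟫_ℝ ≤ ⟪∑ j, X j, X j⟫_ℝ - ‖X j‖ ^ 2 := by
        intro j
        have := sum_mul_inner_le_inner_sum_smul w hw.1 hw.2 (fun i => s i - x i j)
          (fun i => x i j) (fun i i' => h i i' j)
        simp only [smul_sub, Finset.sum_sub_distrib, hS] at this
        change _ ≤ ⟪∑ j, X j - X j, X j⟫_ℝ at this
        rwa [inner_sub_left, real_inner_self_eq_norm_sq] at this
      have hsum := Finset.sum_le_sum fun j (_ : j ∈ Finset.univ) => hj j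
      rw [Finset.sum_sub_distrib, ← inner_sum, real_inner_self_eq_norm_sq, Finset.sum_comm]
        at hsum
      have hleft : ∑ i, ∑ j, w i * ⟪s i - x i j, x i j⟫_ℝ
          = ∑ i, w i * (‖s i‖ ^ 2 - ∑ j, ‖x i j‖ ^ 2) := by
        refine Finset.sum_congr rfl fun i _ => ?_
        rw [← Finset.mul_sum]
        simp only [inner_sub_left, Finset.sum_sub_distrib, ← inner_sum,
          real_inner_self_eq_norm_sq]
        rw [← real_inner_self_eq_norm_sq (s i)]
      have hvar : 0 ≤ r * ∑ j, ‖X j‖ ^ 2 - ‖∑ j, X j‖ ^ 2 := by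
        have h1 := sum_sum_norm_sub_sq X
        have h2 : 0 ≤ ∑ j, ∑ j', ‖X j - X j'‖ ^ 2 := by positivity
        linarith
      rw [hleft] at hsum
      have hm : ∑ i, w i • r⁻¹ • s i = r⁻¹ • ∑ j, X j := by
        rw [← hS, Finset.smul_sum]
        exact Finset.sum_congr rfl fun i _ => smul_comm _ _ _
      simp only [← mul_div_assoc]
      rw [hm, norm_smul, mul_pow, ← Finset.sum_div, div_le_iff₀ (mul_pos hr0 hr2),
        Real.norm_eq_abs, sq_abs]
      refine hsum.trans ?_
      have : r⁻¹ ^ 2 * ‖∑ j, X j‖ ^ 2 * (r * (r - 1))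
          = ‖∑ j, X j‖ ^ 2 - r⁻¹ * ‖∑ j, X j‖ ^ 2 := by
        field_simp
      rw [this]
      have : r⁻¹ * ‖∑ j, X j‖ ^ 2 ≤ ∑ j, ‖X j‖ ^ 2 := by
        rw [inv_mul_le_iff₀ hr0]
        linarith
      linarith)
  refine ⟨c, fun i => ?_⟩
  have hi := hc i
  have e1 : ‖∑ j, (x i j - c)‖ ^ 2 = ‖s i‖ ^ 2 - 2 * (r * ⟪s i, c⟫_ℝ) + r ^ 2 * ‖c‖ ^ 2 := by
    rw [Finset.sum_sub_distrib, Finset.sum_const, Finset.card_univ, ← Nat.cast_smul_eq_nsmul ℝ,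
      norm_sub_sq_real, real_inner_smul_right, norm_smul, mul_pow, Real.norm_eq_abs, sq_abs]
  have e2 : ∑ j, ‖x i j - c‖ ^ 2 = ∑ j, ‖x i j‖ ^ 2 - 2 * ⟪s i, c⟫_ℝ + r * ‖c‖ ^ 2 := by
    simp only [norm_sub_sq_real, Finset.sum_add_distrib, Finset.sum_sub_distrib,
      Finset.sum_const, Finset.card_univ, nsmul_eq_mul, ← Finset.mul_sum, hs, sum_inner, hr]
  have e3 : ((‖s i‖ ^ 2 - ∑ j, ‖x i j‖ ^ 2) / (r * (r - 1)) - 2 * ⟪r⁻¹ • s i, c⟫_ℝ + ‖c‖ ^ 2)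
      * (r * (r - 1)) = ‖∑ j, (x i j - c)‖ ^ 2 - ∑ j, ‖x i j - c‖ ^ 2 := by
    rw [e1, e2, real_inner_smul_left]
    field_simp
    ring
  have := mul_nonpos_of_nonpos_of_nonneg hi (mul_pos hr0 hr2).le
  linarith

/-- If `‖∑ j, y j‖ ^ 2 ≤ ∑ j, ‖y j‖ ^ 2` and the mutual distances are at most `D`, then the
centroid of `y` has norm at most `D / √(2r)`. -/
theorem norm_centroid_le_div_sqrt {κ E : Type*} [Fintype κ] [Nontrivial κ]
    [NormedAddCommGroup E] [InnerProductSpace ℝ E] (y : κ → E) (D : ℝ) (hD0 : 0 ≤ D)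
    (hD : ∀ j j', j ≠ j' → ‖y j - y j'‖ ≤ D) (h : ‖∑ j, y j‖ ^ 2 ≤ ∑ j, ‖y j‖ ^ 2) :
    ‖(Fintype.card κ : ℝ)⁻¹ • ∑ j, y j‖ ≤ D / Real.sqrt (2 * (Fintype.card κ : ℝ)) := by
  classical
  have hsum := sum_sum_norm_sub_sq y
  have hle : ∑ j, ∑ j', ‖y j - y j'‖ ^ 2 
      ≤ ∑ j : κ, ∑ j' : κ, (D ^ 2 - if j = j' then D ^ 2 else 0) := by
    refine Finset.sum_le_sum fun j _ => Finset.sum_le_sum fun j' _ => ?_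
    split_ifs with hjj
    · simp [hjj]
    · rw [sub_zero]
      exact pow_le_pow_left₀ (norm_nonneg _) (hD j j' hjj) 2
  simp only [Finset.sum_sub_distrib, Finset.sum_ite_eq, Finset.mem_univ, if_true,
    Finset.sum_const, Finset.card_univ, nsmul_eq_mul] at hle
  set r : ℝ := (Fintype.card κ : ℝ) with hr
  have hr1 : 1 < r := Nat.one_lt_cast.2 Fintype.one_lt_card
  have hr0 : 0 < r := by linarith
  have hU : ‖∑ j, y j‖ ^ 2 ≤ r * D ^ 2 / 2 := by
    have h1 : r * ‖∑ j, y j‖ ^ 2 ≤ r * ∑ j, ‖y j‖ ^ 2 := by gcongr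
    refine le_of_mul_le_mul_left (a := r - 1) ?_ (by linarith)
    linarith
  refine (pow_le_pow_iff_left₀ (norm_nonneg _) (by positivity) two_ne_zero).1 ?_
  rw [norm_smul, mul_pow, div_pow, Real.sq_sqrt (by positivity), Real.norm_eq_abs, sq_abs]
  calc r⁻¹ ^ 2 * ‖∑ j, y j‖ ^ 2 ≤ r⁻¹ ^ 2 * (r * D ^ 2 / 2) := by gcongr
    _ = D ^ 2 / (2 * r) := by field_simp


/-- **Second colorful no-dimensional Tverberg theorem** (Barabanshchikova, Polyanskii).
For pairwise disjoint sets `Q_1, …, Q_r` (`r ≥ 2`), each of size `k ≥ 2`, in a real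
inner product space, with `D = diam(Q_1, …, Q_r)` the maximum distance between points
from distinct sets, there exist a transversal partition `{P_1, …, P_k}` of the union
(with `|P_i ∩ Q_j| = 1` for all `i, j`) and a point `c` such that the closed ball of
radius `D/√(2r)` centered at `c` intersects the convex hull of every part. -/
theorem second_colorful_no_dimensional_tverberg
    {E : Type*} [NormedAddCommGroup E] [InnerProductSpace ℝ E] [DecidableEq E]
    (k r : ℕ) (hk : 2 ≤ k) (hr : 2 ≤ r)
    (Q : Fin r → Finset E) (hcard : ∀ j, (Q j).card = k)
    (hdisj : ∀ j j', j ≠ j' → Disjoint (Q j) (Q j'))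
    (D : ℝ)
    (hD : D = sSup {d : ℝ | ∃ i j, i ≠ j ∧ ∃ x ∈ Q i, ∃ y ∈ Q j, d = dist x y}) :
    ∃ Pparts : Fin k → Finset E,
      (∀ i i', i ≠ i' → Disjoint (Pparts i) (Pparts i')) ∧
      Finset.univ.biUnion Pparts = Finset.univ.biUnion Q ∧
      (∀ i j, (Pparts i ∩ Q j).card = 1) ∧
      ∃ c : E, ∀ i, ∃ p ∈ convexHull ℝ (↑(Pparts i) : Set E),
        dist p c ≤ D / Real.sqrt (2 * (r : ℝ)) := by
  classical
  have : NeZero k := ⟨by omega⟩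
  have : Nontrivial (Fin r) := Fin.nontrivial_iff_two_le.2 hr
  set e : ∀ j, Fin k ≃ Q j := fun j => ((Q j).equivFinOfCardEq (hcard j)).symm
  obtain ⟨σ, hσ⟩ := exists_perm_forall_swap_inner_nonneg fun j i => (e j i : E)
  set x : Fin k → Fin r → E := fun i j => e j (σ j i) with hx
  have hxQ : ∀ i j, x i j ∈ Q j := fun i j => (e j (σ j i)).2
  have hcol : ∀ i j j', x i j ∈ Q j' → j = j' := fun i j j' hm => by
    by_contra hne
    exact Finset.disjoint_left.1 (hdisj j j' hne) (hxQ i j) hm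
  obtain ⟨c, hc⟩ := exists_norm_sum_sub_sq_le x hσ
  have hbdd : BddAbove {d : ℝ | ∃ i j, i ≠ j ∧ ∃ x ∈ Q i, ∃ y ∈ Q j, d = dist x y} := by
    refine ((Finset.univ.biUnion Q ×ˢ Finset.univ.biUnion Q).image
      fun p => dist p.1 p.2).bddAbove.mono ?_
    rintro d ⟨i, j, -, a, ha, b, hb, rfl⟩
    refine Finset.mem_coe.2 (Finset.mem_image.2 ⟨(a, b), Finset.mem_product.2 ⟨?_, ?_⟩, rfl⟩)
    · exact Finset.mem_biUnion.2 ⟨i, Finset.mem_univ _, ha⟩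
    · exact Finset.mem_biUnion.2 ⟨j, Finset.mem_univ _, hb⟩
  have hdist : ∀ i j j', j ≠ j' → dist (x i j) (x i j') ≤ D := fun i j j' hne => by
    rw [hD]
    exact le_csSup hbdd ⟨j, j', hne, _, hxQ i j, _, hxQ i j', rfl⟩
  have hD0 : 0 ≤ D := by
    obtain ⟨j, j', hne⟩ := exists_pair_ne (Fin r)
    exact dist_nonneg.trans (hdist 0 j j' hne)
  refine ⟨fun i => Finset.univ.image (x i), ?_, ?_, ?_, c, ?_⟩
  · intro i i' hne
    refine Finset.disjoint_left.2 fun a ha ha' => hne ?_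
    obtain ⟨j, -, rfl⟩ := Finset.mem_image.1 ha
    obtain ⟨j', -, hj'⟩ := Finset.mem_image.1 ha'
    obtain rfl := hcol i' j' j (hj' ▸ hxQ i j)
    exact (σ j').injective ((e j').injective (Subtype.ext hj'.symm))
  · ext a
    simp only [Finset.mem_biUnion, Finset.mem_univ, true_and, Finset.mem_image]
    constructor
    · rintro ⟨i, j, rfl⟩
      exact ⟨j, hxQ i j⟩
    · rintro ⟨j, ha⟩
      exact ⟨(σ j).symm ((e j).symm ⟨a, ha⟩), j, by simp [hx]⟩
  · intro i j
    refine Finset.card_eq_one.2 ⟨x i j, ?_⟩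
    ext a
    simp only [Finset.mem_inter, Finset.mem_image, Finset.mem_univ, true_and,
      Finset.mem_singleton]
    constructor
    · rintro ⟨⟨l, rfl⟩, hl⟩
      rw [hcol i l j hl]
    · rintro rfl
      exact ⟨⟨j, rfl⟩, hxQ i j⟩
  · intro i
    have hr0 : (r : ℝ) ≠ 0 := by positivity
    refine ⟨∑ j, (r : ℝ)⁻¹ • x i j, ?_, ?_⟩
    · refine (convex_convexHull ℝ _).sum_mem (fun _ _ => by positivity) ?_ fun j _ =>
        subset_convexHull ℝ _ (by simp)
      simp [hr0]
    · have := norm_centroid_le_div_sqrt (fun j => x i j - c) D hD0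
        (fun j j' hne => by simpa [dist_eq_norm] using hdist i j j' hne) (hc i)
      rw [Fintype.card_fin] at this
      rwa [Finset.sum_sub_distrib, smul_sub, Finset.smul_sum, Finset.sum_const, Finset.card_univ,
        Fintype.card_fin, ← Nat.cast_smul_eq_nsmul ℝ, smul_smul, inv_mul_cancel₀ hr0, one_smul,
        ← dist_eq_norm] at this
end

section
/- Let P be a set of 2n points in the Euclidean plane and let M be a perfect matching of P that maximizes the sum of the distances between matched points over all perfect matchings of P. Then the diametral disks induced by the edges of M have a common point. -/
open scoped RealInnerProductSpace

/-- A self-map of a nonempty finite type agrees with some permutation on its periodic points,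
the permutation being the identity elsewhere. -/
theorem exists_perm_eq_self_or_eq_apply {A : Type*} [Finite A] [Nonempty A] (j : A → A) :
    ∃ π : Equiv.Perm A, (∀ i, π i = i ∨ π i = j i) ∧ ∃ i, π i = j i := by
  classical
  let e : Equiv.Perm (Function.periodicPts j) :=
    Set.BijOn.equiv j (Function.bijOn_periodicPts (f := j))
  refine ⟨Equiv.Perm.ofSubtype e, fun i => ?_, ?_⟩
  · by_cases hi : i ∈ Function.periodicPts j
    · right
      rw [Equiv.Perm.ofSubtype_apply_of_mem e hi]
      rfl
    · left
      exact Equiv.Perm.ofSubtype_apply_of_not_mem e hi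
  · obtain ⟨x⟩ := ‹Nonempty A›
    obtain ⟨m, n, hmn, h⟩ := Finite.exists_ne_map_eq_of_infinite (fun n : ℕ => j^[n] x)
    wlog hlt : m < n generalizing m n
    · exact this n m hmn.symm h.symm (by omega)
    have hi : j^[m] x ∈ Function.periodicPts j := by
      refine Function.mk_mem_periodicPts (n := n - m) (by omega) ?_
      change j^[n - m] (j^[m] x) = j^[m] x
      rw [← Function.iterate_add_apply, Nat.sub_add_cancel hlt.le]
      exact h.symm
    exact ⟨j^[m] x, by rw [Equiv.Perm.ofSubtype_apply_of_mem e hi]; rfl⟩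

/-- The signed area spanned by two plane vectors. -/
def crossProd (x y : EuclideanSpace ℝ (Fin 2)) : ℝ := x 0 * y 1 - x 1 * y 0

theorem inner_eq_coord (x y : EuclideanSpace ℝ (Fin 2)) : ⟪x, y⟫ = x 0 * y 0 + x 1 * y 1 := by
  simp [PiLp.inner_apply, Fin.sum_univ_two, mul_comm]

/-- A polynomial identity for the coordinates of two unit vectors and a third plane vector. -/
theorem sq_sub_sq_eq_of_unit {a b c d : ℝ} (hab : a * a + b * b = 1) (hcd : c * c + d * d = 1)
    (s t : ℝ) :
    (s * (a + c) + t * (b + d)) ^ 2 - (s * s + t * t) * (1 + (a * c + b * d)) ^ 2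
      = 2 * (1 + (a * c + b * d)) * ((a * t - b * s) * (s * d - t * c)) := by
  grind

/-- If the line spanned by `w` meets the angular sector between the unit vectors `x` and `y`,
then `w` makes with `x + y` a small angle, up to sign. -/
theorem norm_mul_one_add_inner_le_abs_inner_add {x y w : EuclideanSpace ℝ (Fin 2)}
    (hx : ‖x‖ = 1) (hy : ‖y‖ = 1) (h : 0 ≤ crossProd x w * crossProd w y) :
    ‖w‖ * (1 + ⟪x, y⟫) ≤ |⟪w, x + y⟫| := by
  have hxy : 0 ≤ 1 + ⟪x, y⟫ := by
    have := abs_real_inner_le_norm x y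
    rw [hx, hy, abs_le] at this
    linarith [this.1]
  refine (sq_le_sq₀ (by positivity) (abs_nonneg _)).1 (sub_nonneg.1 ?_)
  rw [sq_abs]
  have hx2 : x 0 * x 0 + x 1 * x 1 = 1 := by
    rw [← inner_eq_coord, real_inner_self_eq_norm_sq, hx, one_pow]
  have hy2 : y 0 * y 0 + y 1 * y 1 = 1 := by
    rw [← inner_eq_coord, real_inner_self_eq_norm_sq, hy, one_pow]
  have key : ⟪w, x + y⟫ ^ 2 - (‖w‖ * (1 + ⟪x, y⟫)) ^ 2
      = 2 * (1 + ⟪x, y⟫) * (crossProd x w * crossProd w y) := by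
    rw [mul_pow, ← real_inner_self_eq_norm_sq]
    simp only [inner_eq_coord, crossProd, PiLp.add_apply]
    exact sq_sub_sq_eq_of_unit hx2 hy2 _ _
  rw [key]
  positivity

/-- In a positive linear relation among unit plane vectors, for every `i` and every `w` there is
a different `j` such that the line spanned by `w` meets the sector between the `i`-th and `j`-th
vector. -/
theorem exists_crossProd_mul_nonneg {A : Type*} [Fintype A] {μ : A → ℝ}
    {u : A → EuclideanSpace ℝ (Fin 2)} (hμ : ∀ i, 0 < μ i) (hu : ∀ i, ‖u i‖ = 1)
    (hsum : ∑ i, μ i • u i = 0) (i : A) (w : EuclideanSpace ℝ (Fin 2)) :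
    ∃ j, 0 ≤ crossProd (u i) w * crossProd w (u j) ∧ ⟪u i, u j⟫ < 1 := by
  have h0 : ∑ j, μ j * u j 0 = 0 := by
    simpa using congrArg (fun v : EuclideanSpace ℝ (Fin 2) => v 0) hsum
  have h1 : ∑ j, μ j * u j 1 = 0 := by
    simpa using congrArg (fun v : EuclideanSpace ℝ (Fin 2) => v 1) hsum
  by_cases hc : crossProd (u i) w = 0
  · by_contra! H
    have hlt : ∑ j, μ j * ⟪u i, u j⟫ > 0 := by
      refine Finset.sum_pos (fun j _ => mul_pos (hμ j) ?_) ⟨i, Finset.mem_univ i⟩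
      linarith [H j (by simp [hc])]
    have : ∑ j, μ j * ⟪u i, u j⟫ = ⟪u i, ∑ j, μ j • u j⟫ := by
      simp [inner_sum, real_inner_smul_right]
    rw [this, hsum, inner_zero_right] at hlt
    exact lt_irrefl _ hlt
  · have hneg : crossProd (u i) w * crossProd w (u i) < 0 := by
      have : crossProd w (u i) = -crossProd (u i) w := by simp only [crossProd]; ring
      rw [this]
      nlinarith [sq_pos_of_ne_zero hc]
    have hz : ∑ j, μ j * (crossProd (u i) w * crossProd w (u j)) = 0 := by
      have : ∑ j, μ j * (crossProd (u i) w * crossProd w (u j))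
          = crossProd (u i) w * (w 0 * ∑ j, μ j * u j 1 - w 1 * ∑ j, μ j * u j 0) := by
        simp only [Finset.mul_sum, ← Finset.sum_sub_distrib, crossProd]
        exact Finset.sum_congr rfl fun j _ => by ring
      rw [this, h0, h1]
      ring
    obtain ⟨j, -, hj⟩ : ∃ j ∈ Finset.univ,
        0 < μ j * (crossProd (u i) w * crossProd w (u j)) := by
      by_contra! H
      have := Finset.sum_lt_sum H ⟨i, Finset.mem_univ i, mul_neg_of_pos_of_neg (hμ i) hneg⟩
      rw [hz] at this
      simp at this
    have hj' := (mul_pos_iff_of_pos_left (hμ j)).1 hj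
    refine ⟨j, hj'.le, lt_of_le_of_ne ?_ fun h => ?_⟩
    · have := real_inner_le_norm (u i) (u j)
      rwa [hu, hu, one_mul] at this
    · rw [← (inner_eq_one_iff_of_norm_eq_one (hu i) (hu j)).1 h] at hj'
      exact lt_asymm hj' hneg

/-- Segments with half-vectors `w i` and midpoints `d i`, each seen from the origin under an acute
angle, whose midpoints surround the origin, can be rematched with a larger sum of distances. -/
theorem exists_rematching_of_surround {A : Type*} [Fintype A] [Nonempty A] {c : A → ℝ}
    {d w : A → EuclideanSpace ℝ (Fin 2)} (hc : ∀ i, 0 < c i) (hsum : ∑ i, c i • d i = 0)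
    (hw : ∀ i, ‖w i‖ < ‖d i‖) :
    ∃ (π : Equiv.Perm A) (ε : A → ℝ), (∀ i, ε i = 1 ∨ ε i = -1) ∧
      ∑ i, 2 * ‖w i‖ < ∑ i, ‖(d (π i) + ε (π i) • w (π i)) - (d i - ε i • w i)‖ := by
  classical
  have hd : ∀ i, 0 < ‖d i‖ := fun i => (norm_nonneg _).trans_lt (hw i)
  set u : A → EuclideanSpace ℝ (Fin 2) := fun i => ‖d i‖⁻¹ • d i with hudef
  have hu : ∀ i, ‖u i‖ = 1 := fun i => by
    simp [hudef, norm_smul, (hd i).ne']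
  have hdu : ∀ i, d i = ‖d i‖ • u i := fun i => by
    simp [hudef, smul_smul, (hd i).ne']
  have hsum' : ∑ i, (c i * ‖d i‖) • u i = 0 := by
    rw [← hsum]
    exact Finset.sum_congr rfl fun i _ => by rw [mul_smul, ← hdu]
  choose j hj hj1 using fun i => exists_crossProd_mul_nonneg
    (fun i => mul_pos (hc i) (hd i)) hu hsum' i (w i)
  obtain ⟨π, hπ, i₀, hi₀⟩ := exists_perm_eq_self_or_eq_apply j
  have hjne : ∀ i, j i ≠ i := fun i h => by
    have := hj1 i
    rw [h, real_inner_self_eq_norm_sq, hu] at this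
    norm_num at this
  let ε : A → ℝ := fun i => if 0 ≤ ⟪w i, u i + u (j i)⟫ then 1 else -1
  have hε : ∀ i, ε i = 1 ∨ ε i = -1 := fun i => by
    simp only [ε]; split_ifs <;> simp
  have hεw : ∀ i, ⟪ε i • w i, u i + u (j i)⟫ = |⟪w i, u i + u (j i)⟫| := fun i => by
    rw [real_inner_smul_left]
    simp only [ε]
    split_ifs with h
    · rw [abs_of_nonneg h, one_mul]
    · rw [abs_of_neg (not_le.1 h), neg_one_mul]
  let α : A → ℝ := fun i => if π i = i then 2 * ‖w i‖ else ⟪d i + ε i • w i, u i⟫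
  let β : A → ℝ := fun i => if π i = i then 0 else ⟪d i - ε i • w i, u (π i)⟫
  have hαβ : ∀ i, π i ≠ i → 2 * ‖w i‖ < α i - β i := fun i hi => by
    have hji : π i = j i := (hπ i).resolve_left hi
    simp only [α, β, if_neg hi, hji]
    have h1 := norm_mul_one_add_inner_le_abs_inner_add (hu i) (hu (j i)) (hj i)
    rw [← hεw, inner_add_right] at h1
    have h2 : ⟪d i, u i⟫ = ‖d i‖ := by
      conv_lhs => rw [hdu i, real_inner_smul_left, real_inner_self_eq_norm_sq, hu]
      ring
    have h3 : ⟪d i, u (j i)⟫ = ‖d i‖ * ⟪u i, u (j i)⟫ := by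
      conv_lhs => rw [hdu i, real_inner_smul_left]
    rw [inner_add_left, inner_sub_left, h2, h3]
    nlinarith [hw i, hj1 i]
  refine ⟨π, ε, hε, ?_⟩
  calc ∑ i, 2 * ‖w i‖ < ∑ i, (α i - β i) := by
        refine Finset.sum_lt_sum (fun i _ => ?_)
          ⟨i₀, Finset.mem_univ _, hαβ i₀ (hi₀ ▸ hjne i₀)⟩
        by_cases hi : π i = i
        · simp [α, β, hi]
        · exact (hαβ i hi).le
    _ = ∑ i, (α (π i) - β i) := by
        rw [Finset.sum_sub_distrib, Finset.sum_sub_distrib, Equiv.sum_comp π α]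
    _ ≤ _ := by
        refine Finset.sum_le_sum fun i _ => ?_
        by_cases hi : π i = i
        · simp only [α, β, hi, if_true]
          have : d i + ε i • w i - (d i - ε i • w i) = (2 * ε i) • w i := by module
          rw [this, norm_smul]
          rcases hε i with h | h <;> simp [h]
        · have hi' : π (π i) ≠ π i := fun h => hi (π.injective h)
          simp only [α, β, if_neg hi, if_neg hi', ← inner_sub_left]
          have := real_inner_le_norm
            (d (π i) + ε (π i) • w (π i) - (d i - ε i • w i)) (u (π i))
          rwa [hu, mul_one] at this

/-- Finitely many balls either have a common point, or some convex combination `z` of their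
centres lies outside every ball whose centre is actually used. -/
theorem exists_common_point_or_surround {E F : Type*} [Fintype E] [Nonempty E]
    [NormedAddCommGroup F] [InnerProductSpace ℝ F] (m : E → F) (r : E → ℝ) (hr : ∀ i, 0 ≤ r i) :
    (∃ z, ∀ i, ‖m i - z‖ ≤ r i) ∨
      ∃ (z : F) (l : E → ℝ), (∀ i, 0 ≤ l i) ∧ ∑ i, l i = 1 ∧ ∑ i, l i • (m i - z) = 0 ∧
        ∀ i, 0 < l i → r i < ‖m i - z‖ := by
  classical
  let k : E → ℝ := fun i => ‖m i‖ ^ 2 - r i ^ 2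
  let g : (E → ℝ) → ℝ := fun l => ∑ i, l i * k i - ‖∑ i, l i • m i‖ ^ 2
  obtain ⟨l, hl, hlmax⟩ := (isCompact_stdSimplex ℝ E).exists_isMaxOn
    ⟨_, single_mem_stdSimplex ℝ (Classical.arbitrary E)⟩
    (f := g) (by fun_prop)
  set z := ∑ i, l i • m i with hz
  set φ : E → ℝ := fun i => ‖m i - z‖ ^ 2 - r i ^ 2 with hφ
  have hφk : ∀ i, φ i = k i - 2 * ⟪m i, z⟫ + ‖z‖ ^ 2 := fun i => by
    simp only [hφ, k, norm_sub_sq_real]; ring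
  have hinner : ∑ i, l i * ⟪m i, z⟫ = ‖z‖ ^ 2 := by
    rw [← real_inner_self_eq_norm_sq]
    conv_rhs => enter [2]; rw [hz]
    simp [sum_inner, real_inner_smul_left]
  have havg : ∑ i, l i * φ i = g l := by
    simp only [hφk, mul_add, mul_sub, Finset.sum_add_distrib, Finset.sum_sub_distrib,
      ← Finset.sum_mul, hl.2, mul_left_comm _ (2 : ℝ), ← Finset.mul_sum, hinner, g, ← hz]
    ring
  have hle : ∀ j, φ j ≤ g l := fun j => by
    by_contra! hlt
    have hmem : ∀ t ∈ Set.Icc (0 : ℝ) 1, g ((1 - t) • l + t • Pi.single j 1) ≤ g l := fun t ht =>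
      hlmax (convex_stdSimplex ℝ E hl (single_mem_stdSimplex ℝ j)
        (by linarith [ht.2]) ht.1 (by ring))
    have hexp : ∀ t : ℝ, g ((1 - t) • l + t • Pi.single j 1)
        = g l + t * (φ j - g l) - t ^ 2 * ‖m j - z‖ ^ 2 := fun t => by
      have e1 : ∑ i, ((1 - t) • l + t • (Pi.single j 1 : E → ℝ)) i • m i = z + t • (m j - z) := by
        simp only [Pi.add_apply, Pi.smul_apply, smul_eq_mul, add_smul, mul_smul,
          Finset.sum_add_distrib, ← Finset.smul_sum, ← hz, Pi.single_apply, ite_smul, one_smul,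
          zero_smul, Finset.sum_ite_eq', Finset.mem_univ, if_true]
        module
      have e2 : ∑ i, ((1 - t) • l + t • (Pi.single j 1 : E → ℝ)) i * k i
          = (1 - t) * ∑ i, l i * k i + t * k j := by
        simp [add_mul, mul_assoc, Finset.sum_add_distrib, ← Finset.mul_sum, Pi.single_apply]
      simp only [g, e1, e2, ← hz, hφk]
      rw [norm_add_sq_real, inner_smul_right, norm_smul, inner_sub_right,
        real_inner_self_eq_norm_sq, real_inner_comm, mul_pow, Real.norm_eq_abs, sq_abs]
      ring
    set δ := φ j - g l
    have hδ : 0 < δ := sub_pos.2 hlt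
    set D := ‖m j - z‖ ^ 2
    have hD : 0 ≤ D := sq_nonneg _
    have hDδ : 0 < D + δ := by linarith
    have h := hmem (δ / (D + δ)) ⟨by positivity, (div_le_one hDδ).2 (by linarith)⟩
    rw [hexp] at h
    have : δ / (D + δ) * δ - (δ / (D + δ)) ^ 2 * D = (δ / (D + δ)) ^ 2 * δ := by
      field_simp
      ring
    have : 0 < (δ / (D + δ)) ^ 2 * δ := by positivity
    linarith
  rcases le_or_gt (g l) 0 with h0 | h0
  · left
    refine ⟨z, fun i => abs_le_of_sq_le_sq' ?_ (hr i) |>.2⟩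
    have := hle i
    simp only [hφ] at this
    linarith
  · right
    refine ⟨z, l, hl.1, hl.2, ?_, fun i hi => ?_⟩
    · simp [smul_sub, Finset.sum_sub_distrib, ← Finset.sum_smul, hl.2, ← hz]
    · have hzero : ∑ i, l i * (g l - φ i) = 0 := by
        simp only [mul_sub, Finset.sum_sub_distrib, ← Finset.sum_mul, hl.2, havg]
        ring
      have := (Finset.sum_eq_zero_iff_of_nonneg
        fun i _ => mul_nonneg (hl.1 i) (sub_nonneg.2 (hle i))).1 hzero i (Finset.mem_univ i)
      have h2 := (mul_eq_zero.1 this).resolve_left hi.ne'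
      simp only [hφ] at h2
      exact lt_of_pow_lt_pow_left₀ 2 (norm_nonneg _) (by linarith)

/-- Exchanging partners along a permutation of the edges of a perfect matching, the edges being
oriented and some of them being left alone, does not increase the sum of a maximum matching. -/
theorem sum_dist_perm_le {V X E : Type*} [Fintype V] [Fintype E] [PseudoMetricSpace X]
    (p : V → X) {f : V → V}
    (hmax : ∀ g : V → V, (∀ i, g (g i) = i) → (∀ i, g i ≠ i) →
      ∑ i, dist (p i) (p (g i)) ≤ ∑ i, dist (p i) (p (f i)))
    (t : E → V) (ht : Function.Bijective (Sum.elim t (f ∘ t))) (hinv : ∀ i, f (f i) = i)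
    (π : Equiv.Perm E) :
    ∑ e, dist (p (t (π e))) (p (f (t e))) ≤ ∑ e, dist (p (t e)) (p (f (t e))) := by
  let Φ : E ⊕ E ≃ V := Equiv.ofBijective _ ht
  let σ : E ⊕ E → E ⊕ E := Sum.elim (fun e => .inr (π.symm e)) (fun e => .inl (π e))
  have hσ : ∀ x, σ (σ x) = x := by rintro (e | e) <;> simp [σ]
  have hσ' : ∀ x, σ x ≠ x := by rintro (e | e) <;> simp [σ]
  have h := hmax (fun i => Φ (σ (Φ.symm i))) (fun i => by simp [hσ]) (fun i hi => by
    rw [← Equiv.eq_symm_apply] at hi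
    exact hσ' _ hi)
  rw [← Equiv.sum_comp Φ, ← Equiv.sum_comp Φ, Fintype.sum_sum_type, Fintype.sum_sum_type] at h
  have hl : ∀ e, Φ (.inl e) = t e := fun _ => rfl
  have hr : ∀ e, Φ (.inr e) = f (t e) := fun _ => rfl
  simp only [Equiv.symm_apply_apply] at h
  simp only [σ, Sum.elim_inl, Sum.elim_inr, hl, hr, hinv] at h
  have h1 : ∑ e, dist (p (t e)) (p (f (t (π.symm e)))) = ∑ e, dist (p (t (π e))) (p (f (t e))) := by
    rw [← Equiv.sum_comp π]
    simp
  have h2 : ∑ e, dist (p (f (t e))) (p (t (π e))) = ∑ e, dist (p (t (π e))) (p (f (t e))) :=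
    Finset.sum_congr rfl fun e _ => dist_comm _ _
  have h3 : ∑ e, dist (p (f (t e))) (p (t e)) = ∑ e, dist (p (t e)) (p (f (t e))) :=
    Finset.sum_congr rfl fun e _ => dist_comm _ _
  linarith

/-- **Max-sum matchings are Tverberg matchings in the plane** (Bereg et al.).
Let `p` enumerate `2n` distinct points in the Euclidean plane and let the perfect
matching given by a fixed-point-free involution `f` (pairing `p i` with `p (f i)`)
maximize the sum of distances between matched points over all perfect matchings.
Then the diametral disks of its edges have a common point `c`: a point whose distance
to each midpoint of `p i` and `p (f i)` is at most `dist (p i) (p (f i)) / 2`. -/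
theorem max_sum_matching_is_tverberg
    (n : ℕ) (p : Fin (2 * n) → EuclideanSpace ℝ (Fin 2))
    (hp : Function.Injective p)
    (f : Fin (2 * n) → Fin (2 * n))
    (hinv : ∀ i, f (f i) = i) (hfix : ∀ i, f i ≠ i)
    (hmax : ∀ g : Fin (2 * n) → Fin (2 * n),
      (∀ i, g (g i) = i) → (∀ i, g i ≠ i) →
      ∑ i, dist (p i) (p (g i)) ≤ ∑ i, dist (p i) (p (f i))) :
    ∃ c : EuclideanSpace ℝ (Fin 2),
      ∀ i, dist c (midpoint ℝ (p i) (p (f i))) ≤ dist (p i) (p (f i)) / 2 := by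
  classical
  let E := {i : Fin (2 * n) // i < f i}
  have hcover : ∀ i : Fin (2 * n), ∃ e : E, i = e ∨ i = f e := fun i => by
    rcases lt_or_gt_of_ne (hfix i) with h | h
    · exact ⟨⟨f i, by rwa [hinv]⟩, .inr (hinv i).symm⟩
    · exact ⟨⟨i, h⟩, .inl rfl⟩
  rcases isEmpty_or_nonempty E with hE | hE
  · exact ⟨0, fun i => (hE.false (hcover i).choose).elim⟩
  let m : E → EuclideanSpace ℝ (Fin 2) := fun e => midpoint ℝ (p e) (p (f e))
  let w : E → EuclideanSpace ℝ (Fin 2) := fun e => (2⁻¹ : ℝ) • (p e - p (f e))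
  have hw : ∀ e, ‖w e‖ = dist (p e) (p (f e)) / 2 := fun e => by
    simp only [w, norm_smul, dist_eq_norm]
    norm_num
    ring
  rcases exists_common_point_or_surround m (fun e => ‖w e‖) (fun e => norm_nonneg _) with
    ⟨z, hz⟩ | ⟨z, l, hl0, hl1, hlsum, hlt⟩
  · refine ⟨z, fun i => ?_⟩
    obtain ⟨e, rfl | rfl⟩ := hcover i
    · rw [dist_comm, dist_eq_norm, ← hw]
      exact hz e
    · rw [hinv, midpoint_comm, dist_comm, dist_eq_norm, dist_comm (p (f e)), ← hw]
      exact hz e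
  · exfalso
    let A := {e : E // 0 < l e}
    have hA : Nonempty A := by
      by_contra hne
      have : ∀ e, l e = 0 := fun e => le_antisymm (not_lt.1 fun h => hne ⟨⟨e, h⟩⟩) (hl0 e)
      simp [this] at hl1
    have hAsum : ∑ a : A, l a • (m a - z) = 0 := by
      rw [← hlsum, ← Fintype.sum_subtype_add_sum_subtype (fun e => 0 < l e), left_eq_add]
      refine Finset.sum_eq_zero fun e _ => ?_
      rw [le_antisymm (not_lt.1 e.2) (hl0 e), zero_smul]
    obtain ⟨π, ε, hε, hlt'⟩ := exists_rematching_of_surround (A := A) (c := fun a => l a)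
      (d := fun a => m a - z) (w := fun a => w a) (fun a => a.2) hAsum (fun a => hlt a a.2)
    let t : E → Fin (2 * n) := fun e => if h : 0 < l e then
      if ε ⟨e, h⟩ = 1 then e else f e else e
    have ht : ∀ e, t e = e ∨ t e = f e := fun e => by
      simp only [t]; split_ifs <;> simp
    have hft : ∀ e, f (t e) = e ∨ f (t e) = f e := fun e => by
      rcases ht e with h | h <;> simp [h, hinv]
    have hsep : ∀ e e' : E, ∀ i : Fin (2 * n), (i = e ∨ i = f e) → (i = e' ∨ i = f e') → e = e' := by
      rintro ⟨e, he⟩ ⟨e', he'⟩ i h h'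
      apply Subtype.ext
      rcases h with rfl | rfl <;> rcases h' with h' | h' <;> simp only at h' ⊢
      · exact h'
      · subst h'; rw [hinv] at he; exact absurd he he'.asymm
      · subst h'; rw [hinv] at he'; exact absurd he he'.asymm
      · rw [← hinv e, h', hinv]
    have hbij : Function.Bijective (Sum.elim t (f ∘ t)) := by
      constructor
      · rintro (e | e) (e' | e') h <;> simp only [Sum.elim_inl, Sum.elim_inr,
          Function.comp_apply] at h
        · exact congrArg _ (hsep e e' _ (ht e) (h ▸ ht e'))
        · obtain rfl := hsep e e' _ (ht e) (h ▸ hft e')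
          exact absurd h.symm (hfix _)
        · obtain rfl := hsep e e' _ (hft e) (h ▸ ht e')
          exact absurd h (hfix _)
        · exact congrArg _ (hsep e e' _ (hft e) (h ▸ hft e'))
      · intro i
        obtain ⟨e, he⟩ := hcover i
        rcases ht e with h | h <;> rcases he with rfl | rfl
        · exact ⟨.inl e, h⟩
        · exact ⟨.inr e, by simp [h]⟩
        · exact ⟨.inr e, by simp [h, hinv]⟩
        · exact ⟨.inl e, h⟩
    have hpt : ∀ a : A, p (t a) - z = (m a - z) + ε a • w a ∧
        p (f (t a)) - z = (m a - z) - ε a • w a := fun a => by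
      have hta : t a = if ε a = 1 then (a : Fin (2 * n)) else f a := dif_pos a.2
      simp only [hta, m, w, midpoint_eq_smul_add, invOf_eq_inv]
      rcases hε a with h | h
      · simp only [h, if_true]
        constructor <;> module
      · simp only [h, show ¬ (-1 : ℝ) = 1 by norm_num, if_false, hinv]
        constructor <;> module
    have hle := sum_dist_perm_le p hmax t hbij hinv (Equiv.Perm.ofSubtype π)
    rw [← Fintype.sum_subtype_add_sum_subtype (fun e => 0 < l e),
      ← Fintype.sum_subtype_add_sum_subtype (fun e => 0 < l e) fun e => dist (p (t e)) _] at hle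
    have hrest : ∑ e : {e // ¬ 0 < l e}, dist (p (t (Equiv.Perm.ofSubtype π e))) (p (f (t e)))
        = ∑ e : {e // ¬ 0 < l e}, dist (p (t e)) (p (f (t e))) :=
      Finset.sum_congr rfl fun e _ => by rw [Equiv.Perm.ofSubtype_apply_of_not_mem π e.2]
    have hnew : ∑ a : A, dist (p (t (Equiv.Perm.ofSubtype π a))) (p (f (t a)))
        = ∑ a : A, ‖m (π a) - z + ε (π a) • w (π a) - (m a - z - ε a • w a)‖ :=
      Finset.sum_congr rfl fun a _ => by
        rw [Equiv.Perm.ofSubtype_apply_coe, ← (hpt (π a)).1, ← (hpt a).2, sub_sub_sub_cancel_right,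
          dist_eq_norm]
    have hold : ∑ a : A, dist (p (t a)) (p (f (t a))) = ∑ a : A, 2 * ‖w a‖ :=
      Finset.sum_congr rfl fun a _ => by
        rw [hw]
        rcases ht a with h | h
        · rw [h]; ring
        · rw [h, hinv, dist_comm]; ring
    linarith
end

section
/- Let {a_1 b_1, …, a_n b_n} be a perfect matching of a set of 2n points in the Euclidean plane that maximizes the sum of distances between matched points over all perfect matchings. Then there exists a point o in the plane such that ‖a_i − o‖ + ‖b_i − o‖ ≤ (2/√3)·‖a_i − b_i‖ for every i ∈ {1,…,n}. -/
namespace Fingerhut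

open Finset Equiv

abbrev Plane := EuclideanSpace ℝ (Fin 2)

/-- Twice the signed area of the triangle `x y z`. -/
def orient (x y z : Plane) : ℝ := (y 0 - x 0) * (z 1 - x 1) - (y 1 - x 1) * (z 0 - x 0)

/-- One of the two other matchings of the four points is at least as long as `a a'`, `b b'`. -/
def Swaps (a a' b b' : Plane) : Prop :=
  dist a a' + dist b b' ≤ dist a b + dist a' b' ∨ dist a a' + dist b b' ≤ dist a b' + dist a' b

theorem dist_add_dist_le_of_segments_meet {a a' b b' q : Plane}
    (h : q ∈ segment ℝ a b) (h' : q ∈ segment ℝ a' b') :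
    dist a a' + dist b b' ≤ dist a b + dist a' b' := by
  have e := dist_add_dist_of_mem_segment h
  have e' := dist_add_dist_of_mem_segment h'
  have t₁ := dist_triangle a q a'
  have t₂ := dist_triangle b q b'
  rw [dist_comm q a'] at t₁
  rw [dist_comm b q] at t₂
  linarith

theorem mem_segment_of_smul {a b q : Plane} {r s : ℝ} (hr : 0 ≤ r) (hs : 0 ≤ s) (hrs : 0 < r + s)
    (h : ∀ i, (r + s) * q i = r * a i + s * b i) : q ∈ segment ℝ a b := by
  refine ⟨r / (r + s), s / (r + s), by positivity, by positivity, by field_simp, ?_⟩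
  ext i
  have := h i
  simp only [PiLp.add_apply, PiLp.smul_apply, smul_eq_mul]
  field_simp
  linarith

theorem four_point_of_orient {a a' b b' : Plane} (hab : 0 ≤ orient a b b') (hab' : 0 ≤ orient a' b b')
    (hb : 0 ≤ orient a a' b) (hb' : 0 ≤ orient a a' b') (h : 0 < orient a b b' + orient a a' b) :
    dist a a' + dist b b' ≤ dist a b + dist a' b' := by
  set x := orient a b b' with hx
  set x' := orient a' b b' with hx'
  set y := orient a a' b with hy
  set y' := orient a a' b' with hy'
  have hs : x' + y' = x + y := by
    rw [hx, hx', hy, hy']; simp only [orient]; ring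
  let q : Plane := WithLp.toLp 2 fun i => (x' * a i + y' * b i) / (x' + y')
  have hq : ∀ i, (x' + y') * q i = x' * a i + y' * b i := fun i => by
    have : x' + y' ≠ 0 := by linarith
    simp only [q]
    field_simp
  refine dist_add_dist_le_of_segments_meet (q := q)
    (mem_segment_of_smul hab' hb' (by linarith) hq) (mem_segment_of_smul hab hb h fun i => ?_)
  rw [← hs, hq]
  rw [hx, hx', hy, hy']
  simp only [orient]
  fin_cases i <;> simp <;> ring

theorem orient_eq_zero_param {a b c : Plane} (h : orient a b c = 0) (hne : b ≠ c) :
    ∃ t : ℝ, a = b + t • (c - b) := by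
  by_cases h0 : c 0 - b 0 = 0
  · have h1 : c 1 - b 1 ≠ 0 := fun h1 => hne <| by
      ext i; fin_cases i
      · exact (sub_eq_zero.1 h0).symm
      · exact (sub_eq_zero.1 h1).symm
    refine ⟨(a 1 - b 1) / (c 1 - b 1), ?_⟩
    have : (a 0 - b 0) * (c 1 - b 1) = 0 := by
      simp only [orient] at h; linear_combination (-1) * h + (a 1 - b 1) * h0
    have h2 := (mul_eq_zero.1 this).resolve_right h1
    ext i; fin_cases i
    · simp; rw [h0]; linarith
    · simp; field_simp; ring
  · refine ⟨(a 0 - b 0) / (c 0 - b 0), ?_⟩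
    ext i; fin_cases i
    · simp; field_simp; ring
    · simp only [orient] at h
      simp; field_simp; linear_combination h

theorem four_point_of_collinear {a a' b b' : Plane} (h : orient a b b' = 0)
    (h' : orient a' b b' = 0) :
    dist a a' + dist b b' ≤ dist a b + dist a' b' ∨
      dist a a' + dist b b' ≤ dist a b' + dist a' b := by
  by_cases hne : b = b'
  · subst hne
    left
    have := dist_triangle_right a a' b
    simpa using this
  obtain ⟨s, rfl⟩ := orient_eq_zero_param h hne
  obtain ⟨t, rfl⟩ := orient_eq_zero_param h' hne
  have e₁ : dist (b + s • (b' - b)) (b + t • (b' - b)) = |s - t| * dist b b' := by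
    rw [dist_add_left, dist_eq_norm, ← sub_smul, norm_smul, Real.norm_eq_abs, dist_eq_norm_sub']
  have e₂ : ∀ r : ℝ, dist (b + r • (b' - b)) b = |r| * dist b b' := fun r => by
    rw [dist_self_add_left, norm_smul, Real.norm_eq_abs, dist_eq_norm_sub']
  have e₃ : ∀ r : ℝ, dist (b + r • (b' - b)) b' = |r - 1| * dist b b' := fun r => by
    have : b + r • (b' - b) - b' = (r - 1) • (b' - b) := by module
    rw [dist_eq_norm, this, norm_smul, Real.norm_eq_abs, dist_eq_norm_sub']
  rw [e₁, e₂, e₃, e₂, e₃]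
  have key : |s - t| + 1 ≤ |s| + |t - 1| ∨ |s - t| + 1 ≤ |s - 1| + |t| := by
    grind
  rcases key with k | k
  · left; nlinarith [dist_nonneg (x := b) (y := b')]
  · right; nlinarith [dist_nonneg (x := b) (y := b')]

theorem four_point {a a' b b' : Plane} (hx : 0 ≤ orient a b b' * orient a' b b')
    (hy : 0 ≤ orient a a' b * orient a a' b') :
    Swaps a a' b b' := by
  unfold Swaps
  have hs : orient a' b b' + orient a a' b' = orient a b b' + orient a a' b := by
    simp only [orient]; ring
  have s₁ : orient a' a b = - orient a a' b := by simp only [orient]; ring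
  have s₂ : orient a' a b' = - orient a a' b' := by simp only [orient]; ring
  have s₃ : orient a b' b = - orient a b b' := by simp only [orient]; ring
  have s₄ : orient a' b' b = - orient a' b b' := by simp only [orient]; ring
  by_cases h0 : orient a b b' = 0 ∧ orient a' b b' = 0
  · exact four_point_of_collinear h0.1 h0.2
  have hd := dist_comm a' a
  have hd' := dist_comm b' b
  rcases mul_nonneg_iff.1 hx with ⟨x₁, x₂⟩ | ⟨x₁, x₂⟩ <;>
  rcases mul_nonneg_iff.1 hy with ⟨y₁, y₂⟩ | ⟨y₁, y₂⟩
  · left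
    refine four_point_of_orient x₁ x₂ y₁ y₂ ?_
    grind
  · right
    have := four_point_of_orient (a := a') (a' := a) (b := b) (b' := b') x₂ x₁
      (by linarith) (by linarith) (by grind)
    linarith
  · right
    have := four_point_of_orient (a := a) (a' := a') (b := b') (b' := b) (by linarith) (by linarith)
      (by linarith) (by linarith) (by grind)
    linarith
  · left
    have := four_point_of_orient (a := a') (a' := a) (b := b') (b' := b) (by linarith) (by linarith)
      (by linarith) (by linarith) (by grind)
    linarith

theorem sign_shared {x₀ x₁ x₂ z₀ z₁ z₂ y₀ y₁ y₂ : ℝ}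
    (hx : x₀ * y₀ + x₁ * y₁ + x₂ * y₂ = 0) (hz : z₀ * y₀ + z₁ * y₁ + z₂ * y₂ = 0)
    (h₀ : 0 ≤ x₀) (h₁ : 0 ≤ x₁) (k₀ : 0 ≤ z₀) (k₁ : 0 ≤ z₁) :
    (0 ≤ x₀ * z₀ ∧ 0 ≤ y₁ * y₂) ∨ (0 ≤ x₁ * z₁ ∧ 0 ≤ y₂ * y₀) ∨ (0 ≤ x₂ * z₂ ∧ 0 ≤ y₀ * y₁) := by
  by_contra! h
  obtain ⟨a, b, c⟩ := h
  have a := a (mul_nonneg h₀ k₀)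
  have b := b (mul_nonneg h₁ k₁)
  have hy : 0 < y₀ * y₁ := by
    rcases lt_or_ge 0 y₂ with h | h
    · exact mul_pos_of_neg_of_neg (by by_contra!; nlinarith) (by by_contra!; nlinarith)
    · exact mul_pos (by by_contra!; nlinarith) (by by_contra!; nlinarith)
  have hxz : x₂ * z₂ < 0 := by by_contra! h; linarith [c h]
  rcases lt_or_ge x₂ 0 with h | h
  · have : 0 < x₂ * y₂ * y₂ + (x₀ * y₀ + x₁ * y₁) * y₂ ∨ x₂ * y₂ * y₂ + (x₀ * y₀ + x₁ * y₁) * y₂ < 0 := by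
      right
      have : y₂ ≠ 0 := by rintro rfl; simp at a
      have : 0 < y₂ * y₂ := mul_self_pos.2 this
      nlinarith
    have e : x₂ * y₂ * y₂ + (x₀ * y₀ + x₁ * y₁) * y₂ = 0 := by linear_combination y₂ * hx
    grind
  · have hz2 : z₂ < 0 := by by_contra!; nlinarith
    have : y₂ ≠ 0 := by rintro rfl; simp at a
    have : 0 < y₂ * y₂ := mul_self_pos.2 this
    have e : z₂ * y₂ * y₂ + (z₀ * y₀ + z₁ * y₁) * y₂ = 0 := by linear_combination y₂ * hz
    nlinarith

theorem sign_mixed {D x₀ x₁ x₂ z₀ z₁ z₂ y₀ y₁ : ℝ}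
    (hx : x₀ + x₁ + x₂ = D) (hz : z₀ + z₁ + z₂ = D)
    (c₀ : D * y₀ = x₁ * z₂ - x₂ * z₁) (c₁ : D * y₁ = x₂ * z₀ - x₀ * z₂)
    (d : y₀ - y₁ = x₂ - z₂ ∨ y₀ - y₁ = z₂ - x₂)
    (h₀ : x₀ < 0) (h₁ : 0 ≤ x₁) (h₂ : 0 ≤ x₂) (k₀ : 0 ≤ z₀) (k₁ : z₁ < 0) (k₂ : 0 ≤ z₂) :
    0 ≤ x₂ * z₂ ∧ 0 ≤ y₀ * y₁ := by
  refine ⟨mul_nonneg h₂ k₂, ?_⟩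
  have e₀ : 0 ≤ D * y₀ := by rw [c₀]; nlinarith
  have e₁ : 0 ≤ D * y₁ := by rw [c₁]; nlinarith
  rcases lt_trichotomy D 0 with hD | hD | hD
  · exact mul_nonneg_of_nonpos_of_nonpos (by by_contra!; nlinarith) (by by_contra!; nlinarith)
  · subst hD
    have : x₂ = 0 := by by_contra h; have : 0 < x₂ := by positivity
                        nlinarith
    have : z₂ = 0 := by by_contra h; have : 0 < z₂ := by positivity
                        nlinarith
    have : y₀ = y₁ := by grind
    rw [this]; exact mul_self_nonneg _
  · exact mul_nonneg (by by_contra!; nlinarith) (by by_contra!; nlinarith)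

/-- At least two of the three numbers are nonnegative. -/
def Maj (x₀ x₁ x₂ : ℝ) : Prop := (0 ≤ x₀ ∧ 0 ≤ x₁) ∨ (0 ≤ x₁ ∧ 0 ≤ x₂) ∨ (0 ≤ x₂ ∧ 0 ≤ x₀)

theorem sign_maj {D x₀ x₁ x₂ z₀ z₁ z₂ y₀ y₁ y₂ : ℝ}
    (hx : x₀ + x₁ + x₂ = D) (hz : z₀ + z₁ + z₂ = D)
    (c₀ : D * y₀ = x₁ * z₂ - x₂ * z₁) (c₁ : D * y₁ = x₂ * z₀ - x₀ * z₂)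
    (c₂ : D * y₂ = x₀ * z₁ - x₁ * z₀)
    (d₂ : y₀ - y₁ = z₂ - x₂) (d₀ : y₁ - y₂ = z₀ - x₀) (d₁ : y₂ - y₀ = z₁ - x₁)
    (px : x₀ * y₀ + x₁ * y₁ + x₂ * y₂ = 0) (pz : z₀ * y₀ + z₁ * y₁ + z₂ * y₂ = 0)
    (mx : Maj x₀ x₁ x₂) (mz : Maj z₀ z₁ z₂) :
    (0 ≤ x₀ * z₀ ∧ 0 ≤ y₁ * y₂) ∨ (0 ≤ x₁ * z₁ ∧ 0 ≤ y₂ * y₀) ∨ (0 ≤ x₂ * z₂ ∧ 0 ≤ y₀ * y₁) := by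
  by_cases s₀ : 0 ≤ x₀ ∧ 0 ≤ x₁ ∧ 0 ≤ z₀ ∧ 0 ≤ z₁
  · exact sign_shared px pz s₀.1 s₀.2.1 s₀.2.2.1 s₀.2.2.2
  by_cases s₁ : 0 ≤ x₁ ∧ 0 ≤ x₂ ∧ 0 ≤ z₁ ∧ 0 ≤ z₂
  · have := sign_shared (x₀ := x₁) (x₁ := x₂) (x₂ := x₀) (z₀ := z₁) (z₁ := z₂) (z₂ := z₀)
      (y₀ := y₁) (y₁ := y₂) (y₂ := y₀) (by linarith) (by linarith) s₁.1 s₁.2.1 s₁.2.2.1 s₁.2.2.2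
    tauto
  by_cases s₂ : 0 ≤ x₂ ∧ 0 ≤ x₀ ∧ 0 ≤ z₂ ∧ 0 ≤ z₀
  · have := sign_shared (x₀ := x₂) (x₁ := x₀) (x₂ := x₁) (z₀ := z₂) (z₁ := z₀) (z₂ := z₁)
      (y₀ := y₂) (y₁ := y₀) (y₂ := y₁) (by linarith) (by linarith) s₂.1 s₂.2.1 s₂.2.2.1 s₂.2.2.2
    tauto
  simp only [Maj] at mx mz
  rcases mx with mx | mx | mx <;> rcases mz with mz | mz | mz
  · tauto
  · have := sign_mixed (D := D) (x₀ := x₂) (x₁ := x₀) (x₂ := x₁)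
      (z₀ := z₂) (z₁ := z₀) (z₂ := z₁) (y₀ := y₂) (y₁ := y₀)
      (by linarith) (by linarith) (by linarith) (by linarith) (by grind) (by grind) (by grind)
      (by grind) (by grind) (by grind) (by grind)
    grind
  · have := sign_mixed (D := D) (x₀ := z₁) (x₁ := z₂) (x₂ := z₀)
      (z₀ := x₁) (z₁ := x₂) (z₂ := x₀) (y₀ := (-y₁)) (y₁ := (-y₂))
      (by linarith) (by linarith) (by linarith) (by linarith) (by grind) (by grind) (by grind)
      (by grind) (by grind) (by grind) (by grind)
    grind
  · have := sign_mixed (D := D) (x₀ := z₂) (x₁ := z₀) (x₂ := z₁)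
      (z₀ := x₂) (z₁ := x₀) (z₂ := x₁) (y₀ := (-y₂)) (y₁ := (-y₀))
      (by linarith) (by linarith) (by linarith) (by linarith) (by grind) (by grind) (by grind)
      (by grind) (by grind) (by grind) (by grind)
    grind
  · tauto
  · have := sign_mixed (D := D) (x₀ := x₀) (x₁ := x₁) (x₂ := x₂)
      (z₀ := z₀) (z₁ := z₁) (z₂ := z₂) (y₀ := y₀) (y₁ := y₁)
      (by linarith) (by linarith) (by linarith) (by linarith) (by grind) (by grind) (by grind)
      (by grind) (by grind) (by grind) (by grind)
    grind
  · have := sign_mixed (D := D) (x₀ := x₁) (x₁ := x₂) (x₂ := x₀)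
      (z₀ := z₁) (z₁ := z₂) (z₂ := z₀) (y₀ := y₁) (y₁ := y₂)
      (by linarith) (by linarith) (by linarith) (by linarith) (by grind) (by grind) (by grind)
      (by grind) (by grind) (by grind) (by grind)
    grind
  · have := sign_mixed (D := D) (x₀ := z₀) (x₁ := z₁) (x₂ := z₂)
      (z₀ := x₀) (z₁ := x₁) (z₂ := x₂) (y₀ := (-y₀)) (y₁ := (-y₁))
      (by linarith) (by linarith) (by linarith) (by linarith) (by grind) (by grind) (by grind)
      (by grind) (by grind) (by grind) (by grind)
    grind
  · tauto

theorem exists_swap_of_maj {a a' b₀ b₁ b₂ : Plane}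
    (h : Maj (orient a b₁ b₂) (orient a b₂ b₀) (orient a b₀ b₁))
    (h' : Maj (orient a' b₁ b₂) (orient a' b₂ b₀) (orient a' b₀ b₁)) :
    Swaps a a' b₁ b₂ ∨ Swaps a a' b₂ b₀ ∨ Swaps a a' b₀ b₁ := by
  have := sign_maj (D := orient b₀ b₁ b₂) (y₀ := orient a a' b₀) (y₁ := orient a a' b₁)
    (y₂ := orient a a' b₂) (by simp only [orient]; ring) (by simp only [orient]; ring)
    (by simp only [orient]; ring) (by simp only [orient]; ring) (by simp only [orient]; ring)
    (by simp only [orient]; ring) (by simp only [orient]; ring) (by simp only [orient]; ring)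
    (by simp only [orient]; ring) (by simp only [orient]; ring) h h'
  exact this.imp (fun h => four_point h.1 h.2)
    (Or.imp (fun h => four_point h.1 h.2) fun h => four_point h.1 h.2)

theorem exists_matching_swap (a b : Fin 3 → Plane) :
    ∃ i k, i ≠ k ∧ ∃ j l, j ≠ l ∧ dist (a i) (a k) + dist (b j) (b l) ≤ dist (a i) (b j) + dist (a k) (b l) := by
  have key : ∃ i k, i ≠ k ∧ ∃ j l, j ≠ l ∧ Swaps (a i) (a k) (b j) (b l) := by
    let P : Fin 3 → Prop := fun i =>
      Maj (orient (a i) (b 1) (b 2)) (orient (a i) (b 2) (b 0)) (orient (a i) (b 0) (b 1))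
    have hP : ∀ i, ¬ P i → Maj (orient (a i) (b 0) (b 2)) (orient (a i) (b 2) (b 1)) (orient (a i) (b 1) (b 0)) := by
      intro i hi
      have s : ∀ x y z, orient x y z = - orient x z y := fun x y z => by simp only [orient]; ring
      simp only [P, Maj] at hi
      simp only [Maj]
      rw [s _ (b 0) (b 2), s _ (b 2) (b 1), s _ (b 1) (b 0)]
      grind
    have hpig : ∀ Q : Fin 3 → Prop, ∃ i k, i ≠ k ∧ (Q i ↔ Q k) := fun Q => by
      by_cases h₀ : Q 0 <;> by_cases h₁ : Q 1 <;> by_cases h₂ : Q 2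
      all_goals first
        | exact ⟨0, 1, by decide, by tauto⟩
        | exact ⟨1, 2, by decide, by tauto⟩
        | exact ⟨0, 2, by decide, by tauto⟩
    obtain ⟨i, k, hik, hiff⟩ := hpig P
    refine ⟨i, k, hik, ?_⟩
    by_cases hi : P i
    · rcases exists_swap_of_maj hi (hiff.1 hi) with h | h | h
      · exact ⟨1, 2, by decide, h⟩
      · exact ⟨2, 0, by decide, h⟩
      · exact ⟨0, 1, by decide, h⟩
    · rcases exists_swap_of_maj (hP i hi) (hP k (mt hiff.2 hi)) with h | h | h
      · exact ⟨0, 2, by decide, h⟩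
      · exact ⟨2, 1, by decide, h⟩
      · exact ⟨1, 0, by decide, h⟩
  obtain ⟨i, k, hik, j, l, hjl, h | h⟩ := key
  · exact ⟨i, k, hik, j, l, hjl, h⟩
  · exact ⟨i, k, hik, l, j, hjl.symm, by rwa [dist_comm (b l)]⟩

/-- The sum of the perimeters of two triangles is at most twice the length of a matching which joins
a vertex of one triangle to a vertex of the other and leaves the opposite sides. -/
theorem half_perimeters_le (a b : Fin 3 → Plane) : ∃ i j : Fin 3,
    dist (a 0) (a 1) + dist (a 1) (a 2) + dist (a 2) (a 0) +
      (dist (b 0) (b 1) + dist (b 1) (b 2) + dist (b 2) (b 0)) ≤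
    2 * (dist (a i) (b j) + dist (a (i + 1)) (a (i + 2)) + dist (b (j + 1)) (b (j + 2))) := by
  by_contra! h
  obtain ⟨i, k, hik, j, l, hjl, hs⟩ := exists_matching_swap a b
  have h₁ := h i j
  have h₂ := h k l
  have tri : ∀ (c : Fin 3 → Plane) (i k : Fin 3), i ≠ k →
      dist (c (i + 1)) (c (i + 2)) + dist (c (k + 1)) (c (k + 2)) + dist (c i) (c k) =
        dist (c 0) (c 1) + dist (c 1) (c 2) + dist (c 2) (c 0) := by
    intro c i k hik
    have e₁ := dist_comm (c 1) (c 0)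
    have e₂ := dist_comm (c 2) (c 1)
    have e₃ := dist_comm (c 2) (c 0)
    fin_cases i <;> fin_cases k <;> simp at hik ⊢ <;> linarith
  have := tri a i k hik
  have := tri b j l hjl
  linarith

theorem two_coloring_fin_two (ρ : Perm (Fin 2)) (h : ∀ v, ρ v ≠ v) :
    ∃ χ : Fin 2 → Bool, ∀ v, χ (ρ v) ≠ χ v := by
  revert ρ; decide

theorem two_coloring_fin_four (ρ : Perm (Fin 4)) (h : ∀ v, ρ v ≠ v) :
    ∃ χ : Fin 4 → Bool, ∀ v, χ (ρ v) ≠ χ v := by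
  revert ρ; decide +kernel

theorem two_coloring_or_cube_fin_six (ρ : Perm (Fin 6)) (h : ∀ v, ρ v ≠ v) :
    (∃ χ : Fin 6 → Bool, ∀ v, χ (ρ v) ≠ χ v) ∨ ∀ v, ρ (ρ (ρ v)) = v := by
  suffices (∀ v, ρ (ρ (ρ v)) = v) ∨ ∃ k ∈ [7, 11, 13, 19, 21, 25, 35, 37, 41, 49],
      ∀ v, Nat.testBit k (ρ v) ≠ Nat.testBit k v by
    rcases this with h | ⟨k, -, h⟩
    exacts [.inr h, .inl ⟨fun v => Nat.testBit k v, h⟩]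
  revert ρ; decide +kernel

section Assignment

variable {V : Type*} [Fintype V] [DecidableEq V] {p : V → Plane} {M : ℝ}

omit [DecidableEq V] in
theorem sum_le_of_two_coloring
    (hM : ∀ g : V → V, (∀ v, g (g v) = v) → (∀ v, g v ≠ v) → ∑ v, dist (p v) (p (g v)) ≤ M)
    {ρ : Perm V} {χ : V → Bool} (hχ : ∀ v, χ (ρ v) ≠ χ v) :
    ∑ v, dist (p v) (p (ρ v)) ≤ M := by
  have hne : ∀ v, ρ v ≠ v := fun v h => hχ v (by rw [h])
  have hχ' : ∀ v, χ (ρ v) = !χ v := fun v => Bool.eq_not_of_ne (hχ v)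
  have hχi : ∀ v, χ (ρ.symm v) = !χ v := fun v => by
    have := hχ' (ρ.symm v)
    rw [apply_symm_apply] at this
    rw [this, Bool.not_not]
  have hne' : ∀ v, ρ.symm v ≠ v := fun v h => hne v (by rw [Equiv.symm_apply_eq] at h; exact h.symm)
  have h₁ := hM (fun v => if χ v then ρ v else ρ.symm v)
    (fun v => by cases h : χ v <;> simp [h, hχ', hχi])
    (fun v => by cases h : χ v <;> simp only [if_true, Bool.false_eq_true, if_false, hne, hne', ne_eq, not_false_eq_true])
  have h₂ := hM (fun v => if χ v then ρ.symm v else ρ v)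
    (fun v => by cases h : χ v <;> simp [h, hχ', hχi])
    (fun v => by cases h : χ v <;> simp only [if_true, Bool.false_eq_true, if_false, hne, hne', ne_eq, not_false_eq_true])
  have h₃ : ∑ v, dist (p v) (p (ρ.symm v)) = ∑ v, dist (p v) (p (ρ v)) := by
    rw [← Equiv.sum_comp ρ]
    simp [dist_comm]
  have h₄ : ∑ v, dist (p v) (p (if χ v then ρ v else ρ.symm v)) +
      ∑ v, dist (p v) (p (if χ v then ρ.symm v else ρ v)) =
      ∑ v, dist (p v) (p (ρ v)) + ∑ v, dist (p v) (p (ρ.symm v)) := by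
    rw [← sum_add_distrib, ← sum_add_distrib]
    refine sum_congr rfl fun v _ => ?_
    cases χ v <;> simp [add_comm]
  linarith

omit [DecidableEq V] in
theorem exists_equiv_of_two_orbits (hcard : Fintype.card V = 6) {ρ : Perm V} (hρ : ∀ v, ρ v ≠ v)
    (hc : ∀ v, ρ (ρ (ρ v)) = v) {a b : V} (h₀ : b ≠ a) (h₁ : b ≠ ρ a) (h₂ : b ≠ ρ (ρ a)) :
    ∃ e : Fin 6 ≃ V, ⇑e = ![a, ρ a, ρ (ρ a), b, ρ b, ρ (ρ b)] := by
  have hinj : Function.Injective ![a, ρ a, ρ (ρ a), b, ρ b, ρ (ρ b)] := by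
    have i := ρ.injective
    have e₁ := hρ a
    have e₂ := hρ (ρ a)
    have e₃ := hρ (ρ (ρ a))
    have f₁ := hρ b
    have f₂ := hρ (ρ b)
    have f₃ := hρ (ρ (ρ b))
    have ca := hc a
    have cb := hc b
    have k : ∀ x y, ρ x = ρ y → x = y := fun x y h => i h
    have m₁ : ρ b ≠ a := fun h => by rw [h] at cb; exact h₂ cb.symm
    have m₂ : ρ (ρ b) ≠ a := fun h => by rw [h] at cb; exact h₁ cb.symm
    have m₃ : ρ (ρ b) ≠ ρ a := fun h => m₁ (i h)
    have m₄ : ρ b ≠ ρ (ρ a) := fun h => h₁ (i h)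
    have m₅ : ρ b ≠ ρ a := fun h => h₀ (i h)
    have m₆ : ρ (ρ b) ≠ ρ (ρ a) := fun h => m₅ (i h)
    intro x y hxy
    fin_cases x <;> fin_cases y <;> simp at hxy ⊢ <;> grind
  exact ⟨Equiv.ofBijective _ ((Fintype.bijective_iff_injective_and_card _).2 ⟨hinj, by simp [hcard]⟩),
    rfl⟩

omit [DecidableEq V] in
theorem two_mul_le_of_equiv
    (hM : ∀ g : V → V, (∀ v, g (g v) = v) → (∀ v, g v ≠ v) → ∑ v, dist (p v) (p (g v)) ≤ M)
    (e : Fin 6 ≃ V) :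
    2 * (dist (p (e 0)) (p (e 3)) + dist (p (e 1)) (p (e 2)) + dist (p (e 4)) (p (e 5))) ≤ M := by
  let s : Fin 6 → Fin 6 := ![3, 2, 1, 0, 5, 4]
  have hs : ∀ i, s (s i) = i := by decide
  have hs' : ∀ i, s i ≠ i := by decide
  have := hM (fun v => e (s (e.symm v))) (fun v => by simp [hs]) (fun v h => by
    apply hs' (e.symm v)
    rw [← e.symm_apply_apply (s (e.symm v)), h])
  rw [← Equiv.sum_comp e] at this
  simp only [Fin.sum_univ_six, Equiv.symm_apply_apply] at this
  simp [s] at this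
  rw [dist_comm (p (e 2)), dist_comm (p (e 3)), dist_comm (p (e 5))] at this
  linarith

theorem sum_le_of_cube (hcard : Fintype.card V = 6)
    (hM : ∀ g : V → V, (∀ v, g (g v) = v) → (∀ v, g v ≠ v) → ∑ v, dist (p v) (p (g v)) ≤ M)
    {ρ : Perm V} (hρ : ∀ v, ρ v ≠ v) (hc : ∀ v, ρ (ρ (ρ v)) = v) :
    ∑ v, dist (p v) (p (ρ v)) ≤ M := by
  obtain ⟨a⟩ : Nonempty V := Fintype.card_pos_iff.1 (by omega)
  obtain ⟨b, hb⟩ : ∃ b, b ∉ ({a, ρ a, ρ (ρ a)} : Finset V) := by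
    by_contra! h
    have := (card_le_card fun v (_ : v ∈ univ) => h v).trans card_le_three
    rw [card_univ] at this
    omega
  simp only [mem_insert, mem_singleton, not_or] at hb
  obtain ⟨h₀, h₁, h₂⟩ := hb
  have key : ∀ a b : V, b ≠ a → b ≠ ρ a → b ≠ ρ (ρ a) → 2 * (dist (p a) (p b) +
      dist (p (ρ a)) (p (ρ (ρ a))) + dist (p (ρ b)) (p (ρ (ρ b)))) ≤ M := fun a b h₀ h₁ h₂ => by
    obtain ⟨e, he⟩ := exists_equiv_of_two_orbits hcard hρ hc h₀ h₁ h₂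
    have := two_mul_le_of_equiv hM e
    rw [he] at this
    simpa using this
  have hsum : ∑ v, dist (p v) (p (ρ v)) =
      dist (p a) (p (ρ a)) + dist (p (ρ a)) (p (ρ (ρ a))) + dist (p (ρ (ρ a))) (p a) +
      (dist (p b) (p (ρ b)) + dist (p (ρ b)) (p (ρ (ρ b))) + dist (p (ρ (ρ b))) (p b)) := by
    obtain ⟨e, he⟩ := exists_equiv_of_two_orbits hcard hρ hc h₀ h₁ h₂
    rw [← Equiv.sum_comp e, he, Fin.sum_univ_six]
    simp [hc]
    ring
  obtain ⟨i, j, hij⟩ := half_perimeters_le (fun i => p (![a, ρ a, ρ (ρ a)] i))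
    (fun i => p (![b, ρ b, ρ (ρ b)] i))
  rw [hsum]
  refine hij.trans ?_
  have ca := hc a
  have cb := hc b
  have m₁ : ρ b ≠ a := fun h => h₂ (by rw [← h, hc])
  have m₂ : ρ (ρ b) ≠ a := fun h => h₁ (by rw [← h, hc])
  have k₁ := key (![a, ρ a, ρ (ρ a)] i) (![b, ρ b, ρ (ρ b)] j)
  fin_cases i <;> fin_cases j <;> simp [hc, h₀, h₁, h₂, m₁, m₂] at k₁ ⊢ <;> exact k₁

theorem sum_le_of_derangement (hcard : Fintype.card V ≤ 6) (heven : Even (Fintype.card V))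
    (hM : ∀ g : V → V, (∀ v, g (g v) = v) → (∀ v, g v ≠ v) → ∑ v, dist (p v) (p (g v)) ≤ M)
    {ρ : Perm V} (hρ : ∀ v, ρ v ≠ v) : ∑ v, dist (p v) (p (ρ v)) ≤ M := by
  have transfer : ∀ n (e : V ≃ Fin n), (∃ χ : Fin n → Bool, ∀ v, χ (e.permCongr ρ v) ≠ χ v) →
      ∑ v, dist (p v) (p (ρ v)) ≤ M := fun n e ⟨χ, hχ⟩ =>
    sum_le_of_two_coloring hM (χ := fun v => χ (e v)) fun v => by simpa using hχ (e v)
  have hd : ∀ n (e : V ≃ Fin n) v, e.permCongr ρ v ≠ v := fun n e v h =>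
    hρ (e.symm v) (by simpa [Equiv.permCongr_apply, ← Equiv.eq_symm_apply] using h)
  have e := Fintype.equivFin V
  generalize hn : Fintype.card V = n at *
  interval_cases n
  · exact transfer 0 e ⟨fun _ => true, fun v => v.elim0⟩
  · exact absurd heven (by decide)
  · exact transfer 2 e (two_coloring_fin_two _ (hd 2 e))
  · exact absurd heven (by decide)
  · exact transfer 4 e (two_coloring_fin_four _ (hd 4 e))
  · exact absurd heven (by decide)
  · rcases two_coloring_or_cube_fin_six _ (hd 6 e) with h | h
    · exact transfer 6 e h
    · exact sum_le_of_cube hn hM hρ fun v => by simpa using h (e v)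

/-- If every perfect matching, counted twice, has length at most `M`, then so has every permutation
of at most six points. -/
theorem sum_perm_le (hcard : Fintype.card V ≤ 6) (heven : Even (Fintype.card V))
    (hM : ∀ g : V → V, (∀ v, g (g v) = v) → (∀ v, g v ≠ v) → ∑ v, dist (p v) (p (g v)) ≤ M)
    (ρ : Perm V) : ∑ v, dist (p v) (p (ρ v)) ≤ M := by
  induction hk : #{v | ρ v = v} using Nat.strong_induction_on generalizing ρ with
  | _ k ih =>
    by_cases hρ : ∀ v, ρ v ≠ v
    · exact sum_le_of_derangement hcard heven hM hρ
    push Not at hρ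
    obtain ⟨v, hv⟩ := hρ
    obtain ⟨x, hx⟩ : ∃ x, x ≠ v := by
      have : Nontrivial V := by
        rw [← Fintype.one_lt_card_iff_nontrivial]
        have := Fintype.card_pos_iff.2 ⟨v⟩
        obtain ⟨r, hr⟩ := heven
        omega
      exact exists_ne v
    have hρx : ρ x ≠ v := fun h => hx (ρ.injective (h.trans hv.symm))
    obtain ⟨τ, hτ⟩ : ∃ τ : Perm V, ∀ u, τ u = ρ (swap v x u) :=
      ⟨ρ * swap v x, fun u => Perm.mul_apply _ _ u⟩
    have hlt : #{u | τ u = u} < k := by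
      rw [← hk]
      refine card_lt_card ⟨fun u hu => ?_, fun h => ?_⟩
      · simp only [mem_filter, mem_univ, true_and, hτ] at hu ⊢
        by_cases h₁ : u = v
        · exact h₁ ▸ hv
        by_cases h₂ : u = x
        · subst h₂
          rw [swap_apply_right, hv] at hu
          exact absurd hu.symm h₁
        · rwa [swap_apply_of_ne_of_ne h₁ h₂] at hu
      · have := h (by simpa using hv : v ∈ _)
        simp [hτ] at this
        exact hρx this
    refine le_trans ?_ (ih _ hlt τ rfl)
    have hx' : x ∈ univ.erase v := by simp [hx]
    rw [← add_sum_erase _ _ (mem_univ v), ← add_sum_erase _ _ hx',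
      ← add_sum_erase univ _ (mem_univ v), ← add_sum_erase _ _ hx']
    have hs : ∑ u ∈ (univ.erase v).erase x, dist (p u) (p (τ u)) =
        ∑ u ∈ (univ.erase v).erase x, dist (p u) (p (ρ u)) :=
      sum_congr rfl fun u hu => by
        simp only [mem_erase] at hu
        rw [hτ, swap_apply_of_ne_of_ne hu.2.1 hu.1]
    rw [hs]
    simp only [hτ, swap_apply_left, swap_apply_right, hv, dist_self]
    linarith [dist_triangle (p x) (p v) (p (ρ x))]

end Assignment

section Potential

variable {V : Type*}

/-- The total weight of the arcs between consecutive vertices of a list. -/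
def pathWeight (w : V → V → ℝ) : List V → ℝ
  | x :: y :: l => w x y + pathWeight w (y :: l)
  | _ => 0

theorem pathWeight_append (w : V → V → ℝ) (s t : List V) (u : V) :
    pathWeight w (s ++ u :: t) = pathWeight w (s ++ [u]) + pathWeight w (u :: t) := by
  induction s with
  | nil => simp [pathWeight]
  | cons a s ih =>
    cases s with
    | nil => simp [pathWeight]
    | cons b s =>
      simp only [List.cons_append, pathWeight] at ih ⊢
      rw [ih, add_assoc]

variable [Fintype V] [DecidableEq V]

theorem exists_perm_of_cycle {w : V → V → ℝ} (hw : ∀ v, w v v = 0) (l : List V) (x : V)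
    (hl : (x :: l).Nodup) :
    ∃ ρ : Perm V, (∀ v ∉ x :: l, ρ v = v) ∧ ρ ((x :: l).getLast (by simp)) = x ∧
      ∑ v, w v (ρ v) = pathWeight w (x :: l) + w ((x :: l).getLast (by simp)) x := by
  induction l generalizing x with
  | nil => exact ⟨1, by simp, by simp, by simp [pathWeight, hw]⟩
  | cons y l ih =>
    obtain ⟨hx, hl⟩ := List.nodup_cons.1 hl
    obtain ⟨ρ, h₁, h₂, h₃⟩ := ih y hl
    rw [List.getLast_cons (by simp)]
    set z := (y :: l).getLast (by simp) with hz
    have hzm : z ∈ y :: l := List.getLast_mem _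
    have hzx : z ≠ x := fun h => hx (h ▸ hzm)
    have hyx : y ≠ x := fun h => hx (h ▸ List.mem_cons_self)
    have hρx : ρ x = x := h₁ x hx
    obtain ⟨τ, hτ⟩ : ∃ τ : Perm V, ∀ u, τ u = swap x y (ρ u) :=
      ⟨swap x y * ρ, fun u => Perm.mul_apply _ _ u⟩
    refine ⟨τ, fun v hv => ?_, by rw [hτ, h₂, swap_apply_right], ?_⟩
    · rw [List.mem_cons, not_or] at hv
      rw [hτ, h₁ v hv.2, swap_apply_of_ne_of_ne hv.1]
      exact fun h => hv.2 (h ▸ List.mem_cons_self)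
    · have hz' : z ∈ univ.erase x := by simp [hzx]
      rw [← add_sum_erase _ _ (mem_univ x), ← add_sum_erase _ _ hz'] at h₃ ⊢
      have hs : ∑ v ∈ (univ.erase x).erase z, w v (τ v) =
          ∑ v ∈ (univ.erase x).erase z, w v (ρ v) := sum_congr rfl fun v hv => by
        simp only [mem_erase] at hv
        rw [hτ, swap_apply_of_ne_of_ne]
        · exact fun h => hv.2.1 (ρ.injective (h.trans hρx.symm))
        · exact fun h => hv.1 (ρ.injective (h.trans h₂.symm))
      rw [hs]
      simp only [hτ, hρx, h₂, swap_apply_left, swap_apply_right, hw] at h₃ ⊢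
      rw [pathWeight]
      linarith

/-- A weighted digraph without cycles of positive weight has a potential. -/
theorem exists_potential {w : V → V → ℝ} (hw : ∀ v, w v v = 0)
    (hρ : ∀ ρ : Perm V, ∑ v, w v (ρ v) ≤ 0) : ∃ π : V → ℝ, ∀ u v, w u v ≤ π v - π u := by
  have hmax : ∀ u : V, ∃ t : List V, (u :: t).Nodup ∧
      ∀ s : List V, (u :: s).Nodup → pathWeight w (u :: s) ≤ pathWeight w (u :: t) := fun u => by
    have hfin : {t : List V | (u :: t).Nodup}.Finite :=
      (List.finite_length_le V (Fintype.card V)).subset fun t ht =>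
        (List.nodup_cons.1 ht).2.length_le_card
    exact Set.exists_max_image _ (fun t => pathWeight w (u :: t)) hfin ⟨[], List.nodup_singleton u⟩
  choose t ht hmax using hmax
  refine ⟨fun u => -pathWeight w (u :: t u), fun u x => ?_⟩
  suffices w u x + pathWeight w (x :: t x) ≤ pathWeight w (u :: t u) by linarith
  by_cases hu : u ∈ x :: t x
  · obtain ⟨s, r, hsr⟩ := List.append_of_mem hu
    have hnd := hsr ▸ ht x
    have hr := hmax u r (hnd.sublist (List.sublist_append_right _ _))
    rw [hsr, pathWeight_append]
    suffices w u x + pathWeight w (s ++ [u]) ≤ 0 by linarith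
    cases s with
    | nil =>
      obtain rfl : x = u := by simpa using (List.cons.inj hsr).1
      simp [pathWeight, hw]
    | cons y s =>
      obtain rfl : x = y := (List.cons.inj hsr).1
      have hnd' : (x :: (s ++ [u])).Nodup :=
        hnd.sublist (by simp)
      obtain ⟨ρ, -, -, h⟩ := exists_perm_of_cycle hw _ _ hnd'
      have := hρ ρ
      simp only [← List.cons_append, List.getLast_append_singleton] at h
      linarith
  · exact hmax u (x :: t x) (List.nodup_cons.2 ⟨hu, ht x⟩)

/-- A matching which is maximal among all permutations has an optimal dual solution. -/
theorem exists_vertex_weights {E : Type*} [MetricSpace E] {p : V → E} {f : V → V}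
    (hf : ∀ v, f (f v) = v)
    (hρ : ∀ ρ : Perm V, ∑ v, dist (p v) (p (ρ v)) ≤ ∑ v, dist (p v) (p (f v))) :
    ∃ y : V → ℝ, (∀ v, y v + y (f v) = dist (p v) (p (f v))) ∧
      ∀ u v, dist (p u) (p v) ≤ y u + y v := by
  obtain ⟨π, hπ⟩ := exists_potential
    (w := fun u v => dist (p (f u)) (p v) - dist (p u) (p (f u)))
    (fun v => by rw [dist_comm, sub_self]) (fun ρ => by
      obtain ⟨σ, hσ⟩ : ∃ σ : Perm V, ∀ v, σ v = f v :=
        ⟨Function.Involutive.toPerm f hf, fun _ => rfl⟩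
      have h₁ := hρ (σ.trans ρ)
      have h₂ := Equiv.sum_comp σ (fun v => dist (p (f v)) (p (ρ v)))
      simp only [Equiv.trans_apply, hσ, hf] at h₁ h₂
      rw [sum_sub_distrib]
      linarith)
  refine ⟨fun v => (π v - π (f v) + dist (p v) (p (f v))) / 2, fun v => ?_, fun u v => ?_⟩
  · simp only [hf]
    rw [dist_comm (p (f v))]
    ring
  · have h₁ := hπ (f u) v
    have h₂ := hπ (f v) u
    simp only [hf] at h₁ h₂
    rw [dist_comm (p (f u))] at h₁
    rw [dist_comm (p (f v)), dist_comm (p v) (p u)] at h₂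
    linarith

end Potential

section Discs

variable {ι E : Type*} [Fintype ι] [NormedAddCommGroup E] [InnerProductSpace ℝ E]

theorem norm_sum_smul_sq_eq (u : ι → E) {a : ι → ℝ} (ha : ∑ i, a i = 1) :
    ‖∑ i, a i • u i‖ ^ 2 =
      ∑ i, a i * ‖u i‖ ^ 2 - (∑ i, ∑ j, a i * a j * dist (u i) (u j) ^ 2) / 2 := by
  have h₁ : ∑ i, ∑ j, a i * a j * dist (u i) (u j) ^ 2 = ∑ i, ∑ j, (a i * ‖u i‖ ^ 2 * a j +
      a i * (a j * ‖u j‖ ^ 2) - 2 * (a i * (a j * inner ℝ (u i) (u j)))) :=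
    sum_congr rfl fun i _ => sum_congr rfl fun j _ => by
      rw [dist_eq_norm, norm_sub_sq_real]
      ring
  have h₂ : ‖∑ i, a i • u i‖ ^ 2 = ∑ i, ∑ j, a i * (a j * inner ℝ (u i) (u j)) := by
    rw [← real_inner_self_eq_norm_sq, sum_inner]
    refine sum_congr rfl fun i _ => ?_
    rw [inner_sum]
    refine sum_congr rfl fun j _ => ?_
    rw [real_inner_smul_left, real_inner_smul_right]
  rw [h₁, h₂]
  simp only [sum_sub_distrib, sum_add_distrib, ← mul_sum, ← sum_mul, ha]
  ring

omit [InnerProductSpace ℝ E] in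
theorem sum_mul_dist_sq_le (hcard : Fintype.card ι ≤ 3) {u : ι → E} {y : ι → ℝ}
    (h : ∀ i j, dist (u i) (u j) ≤ y i + y j) {a : ι → ℝ} (ha₀ : ∀ i, 0 ≤ a i)
    (ha : ∑ i, a i = 1) :
    ∑ i, ∑ j, a i * a j * dist (u i) (u j) ^ 2 ≤ 8 / 3 * ∑ i, a i * y i ^ 2 := by
  classical
  have h₁ : ∑ i, ∑ j, a i * a j * dist (u i) (u j) ^ 2 ≤ ∑ i, ∑ j, (a i * y i ^ 2 * a j +
      a i * (a j * y j ^ 2) + 2 * (a i * y i * (a j * y j)) -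
        if i = j then 4 * (a i * y i) ^ 2 else 0) := by
    refine sum_le_sum fun i _ => sum_le_sum fun j _ => ?_
    split_ifs with hij
    · subst hij
      rw [dist_self]
      apply le_of_eq
      ring
    · calc a i * a j * dist (u i) (u j) ^ 2 ≤ a i * a j * (y i + y j) ^ 2 :=
            mul_le_mul_of_nonneg_left (pow_le_pow_left₀ dist_nonneg (h i j) 2)
              (mul_nonneg (ha₀ i) (ha₀ j))
        _ = _ := by ring
  have h₂ : (∑ i, a i * y i) ^ 2 ≤ 3 * ∑ i, (a i * y i) ^ 2 := by
    refine sq_sum_le_card_mul_sum_sq.trans (mul_le_mul_of_nonneg_right ?_ (by positivity))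
    exact_mod_cast hcard
  have h₃ : 0 ≤ ∑ i, a i * (y i - ∑ j, a j * y j) ^ 2 :=
    sum_nonneg fun i _ => mul_nonneg (ha₀ i) (sq_nonneg _)
  generalize hS : ∑ j, a j * y j = S at *
  have h₄ : ∑ i, a i * (y i - S) ^ 2 = ∑ i, a i * y i ^ 2 - S ^ 2 := by
    calc _ = ∑ i, (a i * y i ^ 2 - 2 * S * (a i * y i) + a i * S ^ 2) :=
          sum_congr rfl fun i _ => by ring
      _ = _ := by
        rw [sum_add_distrib, sum_sub_distrib, ← mul_sum, ← sum_mul, ha, hS]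
        ring
  simp only [sum_sub_distrib, sum_add_distrib, ← mul_sum, ← sum_mul, ha, hS, sum_ite_eq, mem_univ,
    if_true] at h₁
  linarith

theorem exists_forall_dist_sq_le [Nonempty ι] (hcard : Fintype.card ι ≤ 3) {u : ι → E} {y : ι → ℝ}
    (h : ∀ i j, dist (u i) (u j) ≤ y i + y j) : ∃ o, ∀ i, dist (u i) o ^ 2 ≤ 4 / 3 * y i ^ 2 := by
  classical
  let F : (ι → ℝ) → ℝ := fun a =>
    ∑ i, a i * (‖u i‖ ^ 2 - 4 / 3 * y i ^ 2) - ‖∑ i, a i • u i‖ ^ 2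
  have hF : Continuous F := by fun_prop
  obtain ⟨a, ha, hmax⟩ := (isCompact_stdSimplex ℝ ι).exists_isMaxOn
    ⟨_, single_mem_stdSimplex ℝ (Classical.arbitrary ι)⟩ hF.continuousOn
  have hFa : F a ≤ 0 := by
    have h₁ := sum_mul_dist_sq_le hcard h ha.1 ha.2
    simp only [F]
    rw [norm_sum_smul_sq_eq u ha.2]
    simp only [mul_sub, sum_sub_distrib, mul_left_comm _ (4 / 3 : ℝ), ← mul_sum]
    linarith
  refine ⟨∑ i, a i • u i, fun j => ?_⟩
  set o := ∑ i, a i • u i with ho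
  have hstep : ∀ t ∈ Set.Ioc (0 : ℝ) 1,
      dist (u j) o ^ 2 - 4 / 3 * y j ^ 2 - F a ≤ t * dist (u j) o ^ 2 := fun t ht => by
    have hmem : (1 - t) • a + t • Pi.single j 1 ∈ stdSimplex ℝ ι :=
      convex_stdSimplex ℝ ι ha (single_mem_stdSimplex ℝ j) (by linarith [ht.2]) ht.1.le (by ring)
    have hle : F ((1 - t) • a + t • Pi.single j 1) ≤ F a := hmax hmem
    have hsum : ∑ i, ((1 - t) • a + t • (Pi.single j 1 : ι → ℝ)) i • u i = o + t • (u j - o) := by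
      simp only [Pi.add_apply, Pi.smul_apply, smul_eq_mul, add_smul, mul_smul, sum_add_distrib,
        ← smul_sum, Pi.single_apply, ite_smul, one_smul, zero_smul, sum_ite_eq', mem_univ,
        if_true, ← ho]
      module
    have hlin : ∀ c : ι → ℝ, ∑ i, ((1 - t) • a + t • (Pi.single j 1 : ι → ℝ)) i * c i =
        (1 - t) * ∑ i, a i * c i + t * c j := fun c => by
      simp [add_mul, mul_assoc, sum_add_distrib, ← mul_sum, Pi.single_apply]
    simp only [F] at hle ⊢
    rw [hsum, hlin, ← ho, norm_add_sq_real, norm_smul, real_inner_smul_right, mul_pow,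
      Real.norm_eq_abs, sq_abs, inner_sub_right, real_inner_self_eq_norm_sq] at hle
    rw [dist_eq_norm]
    have hd := norm_sub_sq_real (u j) o
    rw [real_inner_comm] at hd
    generalize ∑ i, a i * (‖u i‖ ^ 2 - 4 / 3 * y i ^ 2) = A at *
    generalize ‖u j - o‖ ^ 2 = D at *
    rw [← ho]
    have : t * (D - 4 / 3 * y j ^ 2 - (A - ‖o‖ ^ 2)) ≤ t * (t * D) := by
      rw [hd] at *
      nlinarith
    exact le_of_mul_le_mul_left this ht.1
  have hlim : dist (u j) o ^ 2 - 4 / 3 * y j ^ 2 - F a ≤ 0 := by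
    have ht : Filter.Tendsto (fun t : ℝ => t * dist (u j) o ^ 2) (nhdsWithin 0 (Set.Ioi 0))
        (nhds 0) := by
      have : Continuous fun t : ℝ => t * dist (u j) o ^ 2 := by fun_prop
      simpa using (this.tendsto 0).mono_left nhdsWithin_le_nhds
    refine ge_of_tendsto ht ?_
    filter_upwards [Ioc_mem_nhdsGT (zero_lt_one' ℝ)] with t ht using hstep t ht
  linarith

/-- Jung's theorem for pairwise intersecting discs: enlarged by the factor `2 / √3`, they have a
common point. -/
theorem exists_forall_dist_le [FiniteDimensional ℝ E] (hE : Module.finrank ℝ E = 2)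
    {u : ι → E} {y : ι → ℝ} (h : ∀ i j, dist (u i) (u j) ≤ y i + y j) :
    ∃ o, ∀ i, dist (u i) o ≤ 2 / Real.sqrt 3 * y i := by
  have hy : ∀ i, 0 ≤ y i := fun i => by
    have := h i i
    rw [dist_self] at this
    linarith
  obtain ⟨o, ho⟩ := Convex.helly_theorem' (𝕜 := ℝ) (s := univ)
    (F := fun i => Metric.closedBall (u i) (2 / Real.sqrt 3 * y i))
    (fun i _ => convex_closedBall _ _) (fun I _ hI => by
      rw [hE] at hI
      rcases I.eq_empty_or_nonempty with rfl | hne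
      · exact ⟨0, by simp⟩
      have : Nonempty I := hne.to_subtype
      obtain ⟨o, ho⟩ := exists_forall_dist_sq_le (ι := I) (by simpa using hI)
        (u := fun i => u i) (y := fun i => y i) (fun i j => h i j)
      refine ⟨o, Set.mem_iInter₂.2 fun i hi => ?_⟩
      rw [Metric.mem_closedBall, dist_comm]
      have hsq := Real.sq_sqrt (show (0 : ℝ) ≤ 3 by norm_num)
      refine le_of_sq_le_sq ?_ (by have := hy i; positivity)
      have h' := ho ⟨i, hi⟩
      rwa [mul_pow, div_pow, hsq, show (2 : ℝ) ^ 2 = 4 by norm_num])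
  refine ⟨o, fun i => ?_⟩
  have := Set.mem_iInter₂.1 ho i (mem_univ i)
  rwa [Metric.mem_closedBall, dist_comm] at this

end Discs

section Matching

variable {V : Type*} [Fintype V] [DecidableEq V] {p : V → Plane} {f : V → V}

omit [DecidableEq V] in
theorem even_card_of_involution (hf : ∀ v, f (f v) = v) (hfix : ∀ v, f v ≠ v) :
    Even (Fintype.card V) := by
  have : ∑ _v : V, (1 : ZMod 2) = 0 :=
    sum_involution (fun v _ => f v) (fun _ _ => by decide) (fun v _ _ => hfix v)
      (fun _ _ => mem_univ _) (fun v _ => hf v)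
  rw [sum_const, card_univ, nsmul_eq_mul, mul_one] at this
  exact (ZMod.natCast_eq_zero_iff_even).1 this

theorem exists_center_of_card_le_six (hcard : Fintype.card V ≤ 6) (hf : ∀ v, f (f v) = v)
    (hfix : ∀ v, f v ≠ v)
    (hmax : ∀ g : V → V, (∀ v, g (g v) = v) → (∀ v, g v ≠ v) →
      ∑ v, dist (p v) (p (g v)) ≤ ∑ v, dist (p v) (p (f v))) :
    ∃ o, ∀ v, dist (p v) o + dist (p (f v)) o ≤ 2 / Real.sqrt 3 * dist (p v) (p (f v)) := by
  obtain ⟨y, hy, h⟩ := exists_vertex_weights hf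
    (sum_perm_le hcard (even_card_of_involution hf hfix) hmax)
  obtain ⟨o, ho⟩ := exists_forall_dist_le finrank_euclideanSpace_fin h
  exact ⟨o, fun v => by linear_combination ho v + ho (f v) + 2 / Real.sqrt 3 * hy v⟩

theorem sum_subtype_le_of_max
    (hmax : ∀ g : V → V, (∀ v, g (g v) = v) → (∀ v, g v ≠ v) →
      ∑ v, dist (p v) (p (g v)) ≤ ∑ v, dist (p v) (p (f v)))
    (hf : ∀ v, f (f v) = v) (hfix : ∀ v, f v ≠ v) {s : Finset V} (hs : ∀ v ∈ s, f v ∈ s)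
    {g : s → s} (hg : ∀ v, g (g v) = v) (hgfix : ∀ v, g v ≠ v) :
    ∑ v : s, dist (p v) (p (g v)) ≤ ∑ v : s, dist (p v) (p (f v)) := by
  have hs' : ∀ v ∉ s, f v ∉ s := fun v hv h => hv (by simpa [hf] using hs _ h)
  let G : V → V := fun v => if h : v ∈ s then g ⟨v, h⟩ else f v
  have hG : ∀ v : s, G v = g v := fun v => dif_pos v.2
  have hG' : ∀ v ∉ s, G v = f v := fun v hv => dif_neg hv
  have := hmax G
    (fun v => by
      by_cases h : v ∈ s
      · rw [hG ⟨v, h⟩, hG, hg]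
      · rw [hG' v h, hG' _ (hs' v h), hf])
    (fun v => by
      by_cases h : v ∈ s
      · rw [hG ⟨v, h⟩]
        exact fun h' => hgfix ⟨v, h⟩ (Subtype.ext h')
      · rw [hG' v h]
        exact hfix v)
  rw [← sum_add_sum_compl s, ← sum_add_sum_compl s fun v => dist (p v) (p (f v)),
    sum_congr (s₁ := sᶜ) rfl fun v hv => by rw [hG' v (mem_compl.1 hv)], add_le_add_iff_right,
    ← sum_coe_sort s, ← sum_coe_sort s] at this
  simpa only [hG] using this

theorem exists_center (hf : ∀ v, f (f v) = v) (hfix : ∀ v, f v ≠ v)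
    (hmax : ∀ g : V → V, (∀ v, g (g v) = v) → (∀ v, g v ≠ v) →
      ∑ v, dist (p v) (p (g v)) ≤ ∑ v, dist (p v) (p (f v))) :
    ∃ o, ∀ v, dist (p v) o + dist (p (f v)) o ≤ 2 / Real.sqrt 3 * dist (p v) (p (f v)) := by
  obtain ⟨o, ho⟩ := Convex.helly_theorem' (𝕜 := ℝ) (s := univ)
    (F := fun v => {o ∈ Set.univ | dist o (p v) + dist o (p (f v)) ≤
      2 / Real.sqrt 3 * dist (p v) (p (f v))})
    (fun v _ => ((convexOn_univ_dist _).add (convexOn_univ_dist _)).convex_le _)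
    (fun I _ hI => by
      rw [finrank_euclideanSpace_fin] at hI
      have hs : ∀ v ∈ I ∪ I.image f, f v ∈ I ∪ I.image f := fun v hv => by
        rcases mem_union.1 hv with h | h
        · exact mem_union_right _ (mem_image_of_mem f h)
        · obtain ⟨u, hu, rfl⟩ := mem_image.1 h
          exact mem_union_left _ ((hf u).symm ▸ hu)
      obtain ⟨o, ho⟩ := exists_center_of_card_le_six (V := ↥(I ∪ I.image f)) (p := fun v => p v)
        (f := fun v => ⟨f v, hs v v.2⟩)
        (by
          rw [Fintype.card_coe]
          have h₁ := card_union_le I (I.image f)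
          have h₂ := card_image_le (s := I) (f := f)
          omega)
        (fun v => Subtype.ext (hf v)) (fun v h => hfix v (congrArg Subtype.val h))
        (fun g hg hgfix => sum_subtype_le_of_max hmax hf hfix hs hg hgfix)
      refine ⟨o, Set.mem_iInter₂.2 fun v hv => ⟨Set.mem_univ _, ?_⟩⟩
      rw [dist_comm o, dist_comm o]
      exact ho ⟨v, mem_union_left _ hv⟩)
  refine ⟨o, fun v => ?_⟩
  have := (Set.mem_iInter₂.1 ho v (mem_univ v)).2
  rwa [dist_comm o, dist_comm o] at this

end Matching

end Fingerhut

/-- **Fingerhut's conjecture** (proved by Barabanshchikova and Polyanskii).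
Let `p` enumerate `2n` distinct points in the Euclidean plane and let the perfect
matching given by a fixed-point-free involution `f` (pairing `p i` with `p (f i)`)
maximize the sum of distances between matched points over all perfect matchings.
Then there exists a point `o` in the plane such that
`‖p i − o‖ + ‖p (f i) − o‖ ≤ (2/√3)·‖p i − p (f i)‖` for every edge of the matching. -/
theorem fingerhut_conjecture
    (n : ℕ) (p : Fin (2 * n) → EuclideanSpace ℝ (Fin 2))
    (hp : Function.Injective p)
    (f : Fin (2 * n) → Fin (2 * n))
    (hinv : ∀ i, f (f i) = i) (hfix : ∀ i, f i ≠ i)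
    (hmax : ∀ g : Fin (2 * n) → Fin (2 * n),
      (∀ i, g (g i) = i) → (∀ i, g i ≠ i) →
      ∑ i, dist (p i) (p (g i)) ≤ ∑ i, dist (p i) (p (f i))) :
    ∃ o : EuclideanSpace ℝ (Fin 2),
      ∀ i, dist (p i) o + dist (p (f i)) o ≤ (2 / Real.sqrt 3) * dist (p i) (p (f i)) := by
  exact Fingerhut.exists_center hinv hfix hmax
end

section
/- Let R = {r_1, …, r_n} and B = {b_1, …, b_n} be disjoint sets of n red and n blue points in the Euclidean plane, and suppose the perfect red-blue matching {r_1 b_1, …, r_n b_n} maximizes the sum of distances ∑_i ‖r_i − b_i‖ over all bijections between R and B. Then there exists a point o in the plane such that ‖r_i − o‖ + ‖b_i − o‖ ≤ √2·‖r_i − b_i‖ for every i ∈ {1,…,n}. -/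
open Finset in
/-- Along a closed walk, moving from the diagonal of a cost matrix to the traversed entries cannot
increase the total cost if the identity is a permutation of maximum cost. -/
lemma sum_closed_walk_le {ι : Type*} [Fintype ι] [DecidableEq ι] {c : ι → ι → ℝ}
    (hc : ∀ π : Equiv.Perm ι, ∑ i, c i (π i) ≤ ∑ i, c i i)
    (m : ℕ) (v : ℕ → ι) (hv : v m = v 0) :
    ∑ t ∈ range m, (c (v t) (v (t + 1)) - c (v (t + 1)) (v (t + 1))) ≤ 0 := by
  rcases Nat.eq_zero_or_pos m with rfl | hm
  · simp
  have hm' : (0 : ℝ) < m := by exact_mod_cast hm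
  have hshift (g : ι → ℝ) : ∑ t ∈ range m, g (v (t + 1)) = ∑ t ∈ range m, g (v t) := by
    have h := sum_range_sub (fun t ↦ g (v t)) m
    rw [sum_sub_distrib, hv] at h
    linarith
  let M : Matrix ι ι ℝ := fun i j ↦ (if i = j then 1 else 0) +
    (m : ℝ)⁻¹ * ∑ t ∈ range m, ((if v t = i ∧ v (t + 1) = j then 1 else 0) -
      (if v t = i ∧ v t = j then 1 else 0))
  have hcost (g : ι → ι → ℝ) : ∑ i, ∑ j, M i j * g i j =
      ∑ i, g i i + (m : ℝ)⁻¹ * ∑ t ∈ range m, (g (v t) (v (t + 1)) - g (v t) (v t)) := by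
    have h (a b : ι) : ∑ i, ∑ j, (if a = i ∧ b = j then (1 : ℝ) else 0) * g i j = g a b := by
      simp [ite_and]
    simp only [M, add_mul, sum_add_distrib, mul_assoc, ← mul_sum, sum_mul]
    congr 1
    · simp
    · congr 1
      simp_rw [sum_comm (s := (univ : Finset ι)) (t := range m), sub_mul, sum_sub_distrib, h]
  have hM : M ∈ doublyStochastic ℝ ι := by
    rw [mem_doublyStochastic_iff_sum]
    refine ⟨fun i j ↦ ?_, fun i ↦ ?_, fun j ↦ ?_⟩
    · by_cases hij : i = j
      · subst hij
        have h : -(m : ℝ) ≤ ∑ t ∈ range m, ((if v t = i ∧ v (t + 1) = i then (1 : ℝ) else 0) -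
            (if v t = i ∧ v t = i then 1 else 0)) := by
          have := card_nsmul_le_sum (range m) (fun t ↦
            ((if v t = i ∧ v (t + 1) = i then (1 : ℝ) else 0) -
            (if v t = i ∧ v t = i then 1 else 0))) (-1) (fun t _ ↦ by split_ifs <;> norm_num)
          simpa using this
        have h' := mul_le_mul_of_nonneg_left h (inv_nonneg.2 hm'.le)
        rw [mul_neg, inv_mul_cancel₀ hm'.ne'] at h'
        simp only [M, if_true]
        linarith
      · simp only [M, if_neg hij, zero_add]
        refine mul_nonneg (inv_nonneg.2 hm'.le) (sum_nonneg fun t _ ↦ ?_)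
        have : ¬(v t = i ∧ v t = j) := fun h ↦ hij (h.1.symm.trans h.2)
        rw [if_neg this]
        split_ifs <;> norm_num
    · have h := hcost (fun k _ ↦ if k = i then 1 else 0)
      simpa [← sum_mul] using h
    · have h := hcost (fun _ k ↦ if k = j then 1 else 0)
      rw [sum_sub_distrib, hshift (fun k ↦ if k = j then 1 else 0)] at h
      simpa using h
  obtain ⟨w, hw0, hw1, hwM⟩ := exists_eq_sum_perm_of_mem_doublyStochastic hM
  have hle : ∑ i, ∑ j, M i j * c i j ≤ ∑ i, c i i := by
    calc ∑ i, ∑ j, M i j * c i j = ∑ σ, w σ * ∑ i, c i (σ i) := by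
          rw [← hwM]
          simp only [Matrix.sum_apply, Matrix.smul_apply, smul_eq_mul, sum_mul, mul_assoc]
          simp_rw [sum_comm (s := (univ : Finset ι)) (t := (univ : Finset (Equiv.Perm ι))),
            ← mul_sum]
          simp [Equiv.Perm.permMatrix, PEquiv.toMatrix_apply]
      _ ≤ ∑ σ, w σ * ∑ i, c i i :=
          sum_le_sum fun σ _ ↦ mul_le_mul_of_nonneg_left (hc σ) (hw0 σ)
      _ = ∑ i, c i i := by rw [← sum_mul, hw1, one_mul]
  rw [hcost c] at hle
  rw [sum_sub_distrib, hshift (fun k ↦ c k k), ← sum_sub_distrib]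
  by_contra! hpos
  have := mul_pos (inv_pos.2 hm') hpos
  linarith

open Finset in
/-- Dual optimal solutions of the assignment problem, when the identity is an optimal assignment. -/
lemma exists_assignment_potentials {ι : Type*} [Fintype ι] {c : ι → ι → ℝ}
    (hc : ∀ π : Equiv.Perm ι, ∑ i, c i (π i) ≤ ∑ i, c i i) :
    ∃ p q : ι → ℝ, (∀ i j, c i j ≤ p i + q j) ∧ ∀ i, c i i = p i + q i := by
  classical
  let len (m : ℕ) (v : ℕ → ι) : ℝ :=
    ∑ t ∈ range m, (c (v t) (v (t + 1)) - c (v (t + 1)) (v (t + 1)))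
  let S (i : ι) : Set ℝ := {x | ∃ m v, v 0 = i ∧ x = len m v}
  obtain ⟨K, hK⟩ : ∃ K, ∀ i j, c i i - c j i ≤ K := by
    obtain ⟨K, hK⟩ := (Set.finite_range fun x : ι × ι ↦ c x.1 x.1 - c x.2 x.1).bddAbove
    exact ⟨K, fun i j ↦ hK ⟨(i, j), rfl⟩⟩
  have hS (i : ι) : BddAbove (S i) := by
    refine ⟨K, ?_⟩
    rintro _ ⟨m, v, rfl, rfl⟩
    have h := sum_closed_walk_le hc (m + 1) (fun t ↦ if t ≤ m then v t else v 0) (by simp)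
    rw [sum_range_succ] at h
    have h' : ∑ t ∈ range m, (c (if t ≤ m then v t else v 0)
        (if t + 1 ≤ m then v (t + 1) else v 0) - c (if t + 1 ≤ m then v (t + 1) else v 0)
        (if t + 1 ≤ m then v (t + 1) else v 0)) = len m v := by
      refine sum_congr rfl fun t ht ↦ ?_
      have := mem_range.1 ht
      rw [if_pos (by omega), if_pos (by omega)]
    rw [h'] at h
    simp only [le_refl, if_true, Nat.not_succ_le_self, if_false] at h
    linarith [hK (v 0) (v m)]
  have hne (i : ι) : (S i).Nonempty := ⟨_, 0, fun _ ↦ i, rfl, rfl⟩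
  refine ⟨fun i ↦ sSup (S i), fun j ↦ c j j - sSup (S j), fun i j ↦ ?_, fun i ↦ by ring⟩
  suffices sSup (S j) ≤ sSup (S i) - (c i j - c j j) by linarith
  refine csSup_le (hne j) ?_
  rintro _ ⟨m, v, rfl, rfl⟩
  have h : len (m + 1) (fun t ↦ Nat.casesOn t i v) ≤ sSup (S i) :=
    le_csSup (hS i) ⟨m + 1, _, rfl, rfl⟩
  simp only [len, sum_range_succ'] at h
  change len m v + (c i (v 0) - c (v 0) (v 0)) ≤ sSup (S i) at h
  linarith

section InnerProductSpace

variable {E : Type*} [NormedAddCommGroup E] [InnerProductSpace ℝ E]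

lemma inner_pos_of_sqrt_two_mul_norm_sub_lt {x y : E} (h : √2 * ‖x - y‖ < ‖x‖ + ‖y‖) :
    0 < inner ℝ x y := by
  by_contra! hxy
  refine h.not_ge (abs_le_of_sq_le_sq' ?_ (by positivity)).2
  rw [mul_pow, Real.sq_sqrt zero_le_two, norm_sub_sq_real]
  nlinarith [sq_nonneg (‖x‖ - ‖y‖)]

open Filter Topology in
lemma eventually_norm_sub_smul_lt {x h : E} (hx : x ≠ 0) {m : ℝ}
    (hm : m < inner ℝ (‖x‖⁻¹ • x) h) : ∀ᶠ ε in 𝓝[>] (0 : ℝ), ‖x - ε • h‖ < ‖x‖ - ε * m := by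
  have hx' : 0 < ‖x‖ := norm_pos_iff.2 hx
  have hm' : m * ‖x‖ < inner ℝ x h := by
    rwa [real_inner_smul_left, inv_mul_eq_div, lt_div_iff₀ hx'] at hm
  have h1 : ∀ᶠ ε in 𝓝 (0 : ℝ), ε * m < ‖x‖ :=
    (continuous_id.mul continuous_const).continuousAt.eventually_lt continuousAt_const (by simpa)
  have h2 : ∀ᶠ ε in 𝓝 (0 : ℝ), ε * (‖h‖ ^ 2 - m ^ 2) < 2 * (inner ℝ x h - m * ‖x‖) :=
    (continuous_id.mul continuous_const).continuousAt.eventually_lt continuousAt_const (by simpa)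
  filter_upwards [self_mem_nhdsWithin, h1.filter_mono nhdsWithin_le_nhds,
    h2.filter_mono nhdsWithin_le_nhds] with ε hε h1 h2
  rw [Set.mem_Ioi] at hε
  refine lt_of_pow_lt_pow_left₀ 2 (by linarith) ?_
  rw [norm_sub_sq_real, real_inner_smul_right, norm_smul, Real.norm_of_nonneg hε.le]
  nlinarith

/-- If all the `x k` make acute angles with all the `y l`, then zero is not a convex combination of
the sums `x k + y k`. -/
lemma zero_notMem_convexHull_add_of_inner_pos {κ : Type*} {x y : κ → E}
    (h : ∀ k l, 0 < inner ℝ (x k) (y l)) :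
    (0 : E) ∉ convexHull ℝ (Set.range fun k ↦ x k + y k) := by
  intro h0
  obtain ⟨τ, _, w, z, hw0, hw1, hz, hsum⟩ := mem_convexHull_iff_exists_fintype.1 h0
  choose k hk using hz
  simp only [← hk, smul_add, Finset.sum_add_distrib] at hsum
  have hneg : inner ℝ (∑ s, w s • x (k s)) (∑ s, w s • y (k s)) ≤ 0 := by
    rw [eq_neg_of_add_eq_zero_right hsum, inner_neg_right, Left.neg_nonpos_iff]
    exact real_inner_self_nonneg
  obtain ⟨s, -, hs⟩ := Finset.exists_ne_zero_of_sum_ne_zero (hw1.trans_ne one_ne_zero)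
  have hs' : 0 < w s := lt_of_le_of_ne (hw0 s) hs.symm
  refine hneg.not_gt ?_
  simp only [sum_inner, inner_sum, real_inner_smul_left, real_inner_smul_right]
  have hnn (i j : τ) : 0 ≤ w i * (w j * inner ℝ (x (k j)) (y (k i))) :=
    mul_nonneg (hw0 i) (mul_nonneg (hw0 j) (h _ _).le)
  exact Finset.sum_pos' (fun i _ ↦ Finset.sum_nonneg fun j _ ↦ hnn i j) ⟨s, Finset.mem_univ _,
    Finset.sum_pos' (fun j _ ↦ hnn s j) ⟨s, Finset.mem_univ _,
      mul_pos hs' (mul_pos hs' (h _ _))⟩⟩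

open Filter Topology in
/-- If every red ball, centred at `r i` with radius `p i`, meets every blue ball, centred at `b j`
with radius `q j`, then some point is, for all `i` and `j`, within total distance
`√2 * (p i + q j)` of the two centres. The radii may be negative. -/
lemma exists_dist_add_dist_le_sqrt_two_mul [FiniteDimensional ℝ E] {ι : Type*} [Fintype ι]
    (r b : ι → E) (p q : ι → ℝ) (hpq : ∀ i j, dist (r i) (b j) ≤ p i + q j) :
    ∃ o : E, ∀ i j, dist (r i) o + dist (b j) o ≤ √2 * (p i + q j) := by
  cases isEmpty_or_nonempty ι
  · exact ⟨0, fun i ↦ isEmptyElim i⟩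
  have := FiniteDimensional.proper_real E
  let G (k : ι × ι) (o : E) : ℝ := ‖r k.1 - o‖ + ‖b k.2 - o‖ - √2 * (p k.1 + q k.2)
  have hG (k : ι × ι) : Continuous (G k) := by fun_prop
  let F (o : E) : ℝ := Finset.univ.sup' Finset.univ_nonempty fun k ↦ G k o
  have hGF (k : ι × ι) (o : E) : G k o ≤ F o :=
    Finset.le_sup' (fun k ↦ G k o) (Finset.mem_univ k)
  have hF : Continuous F := Continuous.finset_sup'_apply _ fun k _ ↦ hG k
  obtain ⟨k₀⟩ : Nonempty (ι × ι) := inferInstance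
  have hlim : Tendsto F (cocompact E) atTop := by
    refine tendsto_atTop_mono (fun o ↦ ?_) (tendsto_atTop_add_const_right _
      (-(√2 * (p k₀.1 + q k₀.2))) (tendsto_dist_left_cocompact_atTop (r k₀.1)))
    have := hGF k₀ o
    simp only [G] at this
    rw [dist_eq_norm]
    linarith [norm_nonneg (b k₀.2 - o)]
  obtain ⟨o, ho⟩ := hF.exists_forall_le hlim
  refine ⟨o, ?_⟩
  by_contra! hcon
  obtain ⟨i₀, j₀, hij⟩ := hcon
  have hpos : 0 < F o := by
    refine lt_of_lt_of_le ?_ (hGF (i₀, j₀) o)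
    simpa only [G, sub_pos, dist_eq_norm] using hij
  let A := {k : ι × ι // G k o = F o}
  have hcross (k l : A) : √2 * ‖r k.1.1 - b l.1.2‖ < ‖r k.1.1 - o‖ + ‖b l.1.2 - o‖ := by
    have h1 := k.2
    have h2 := l.2
    have h3 := hGF (l.1.1, k.1.2) o
    have h4 := mul_le_mul_of_nonneg_left (hpq k.1.1 l.1.2) (Real.sqrt_nonneg 2)
    rw [dist_eq_norm] at h4
    simp only [G] at h1 h2 h3
    linarith
  have hinner (k l : A) : 0 < inner ℝ (r k.1.1 - o) (b l.1.2 - o) := by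
    refine inner_pos_of_sqrt_two_mul_norm_sub_lt ?_
    rw [sub_sub_sub_cancel_right]
    exact hcross k l
  have hr (k : A) : r k.1.1 - o ≠ 0 := fun h ↦ by simpa [h] using hinner k k
  have hb (k : A) : b k.1.2 - o ≠ 0 := fun h ↦ by simpa [h] using hinner k k
  let x (k : A) : E := ‖r k.1.1 - o‖⁻¹ • (r k.1.1 - o)
  let y (k : A) : E := ‖b k.1.2 - o‖⁻¹ • (b k.1.2 - o)
  have h0 := zero_notMem_convexHull_add_of_inner_pos (x := x) (y := y) fun k l ↦ by
    simp only [x, y, real_inner_smul_left, real_inner_smul_right]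
    exact mul_pos (inv_pos.2 (norm_pos_iff.2 (hb l)))
      (mul_pos (inv_pos.2 (norm_pos_iff.2 (hr k))) (hinner k l))
  obtain ⟨f, u, hu, hf⟩ := geometric_hahn_banach_point_closed (convex_convexHull ℝ _)
    ((Set.finite_range fun k ↦ x k + y k).isClosed_convexHull ℝ) h0
  rw [map_zero] at hu
  obtain ⟨h, rfl⟩ := (InnerProductSpace.toDual ℝ E).surjective f
  have hdesc (k : ι × ι) : ∀ᶠ ε in 𝓝[>] (0 : ℝ), G k (o + ε • h) < F o := by
    rcases (hGF k o).eq_or_lt with hk | hk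
    · have hxy := hu.trans (hf _ (subset_convexHull ℝ _ ⟨⟨k, hk⟩, rfl⟩))
      rw [InnerProductSpace.toDual_apply_apply, real_inner_comm, inner_add_left] at hxy
      set α := inner ℝ (x ⟨k, hk⟩) h
      set β := inner ℝ (y ⟨k, hk⟩) h
      filter_upwards [eventually_norm_sub_smul_lt (hr ⟨k, hk⟩)
        (show (α - β) / 2 < α by linarith), eventually_norm_sub_smul_lt (hb ⟨k, hk⟩)
        (show (β - α) / 2 < β by linarith)] with ε h1 h2
      rw [← hk]
      simp only [G, ← sub_sub]
      linarith
    · have hc : Continuous fun ε : ℝ ↦ G k (o + ε • h) := (hG k).comp (by fun_prop)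
      exact (hc.continuousAt.eventually_lt continuousAt_const (by simpa)).filter_mono
        nhdsWithin_le_nhds
  obtain ⟨ε, hε⟩ := (eventually_all.2 hdesc).exists
  refine (ho (o + ε • h)).not_gt ?_
  exact (Finset.sup'_lt_iff _).2 fun k _ ↦ hε k

end InnerProductSpace

/-- **Colorful Fingerhut conjecture in the plane** (Pérez-Lantero, Seara).
Let `r 0, …, r (n-1)` be `n` red points and `b 0, …, b (n-1)` be `n` blue points (all
distinct) in the Euclidean plane, and suppose the red-blue matching pairing `r i` with
`b i` maximizes the sum of distances between matched points over all bijections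
between the red and blue points. Then there exists a point `o` in the plane with
`‖r i − o‖ + ‖b i − o‖ ≤ √2·‖r i − b i‖` for every `i`. -/
theorem colorful_fingerhut_plane
    (n : ℕ) (r b : Fin n → EuclideanSpace ℝ (Fin 2))
    (hr : Function.Injective r) (hb : Function.Injective b)
    (hrb : ∀ i j, r i ≠ b j)
    (hmax : ∀ π : Equiv.Perm (Fin n),
      ∑ i, dist (r i) (b (π i)) ≤ ∑ i, dist (r i) (b i)) :
    ∃ o : EuclideanSpace ℝ (Fin 2),
      ∀ i, dist (r i) o + dist (b i) o ≤ Real.sqrt 2 * dist (r i) (b i) := by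
  obtain ⟨p, q, hpq, hdiag⟩ := exists_assignment_potentials (c := fun i j ↦ dist (r i) (b j)) hmax
  obtain ⟨o, ho⟩ := exists_dist_add_dist_le_sqrt_two_mul r b p q hpq
  exact ⟨o, fun i ↦ (hdiag i).symm ▸ ho i i⟩
end

section
/- For any finite set of n ≥ 3 points in the Euclidean plane, there exists a Hamiltonian cycle on these points, i.e., a cyclic ordering p_1, p_2, …, p_n (indices modulo n) of the points, such that the n diametral disks B(p_i p_{i+1}) induced by consecutive points have a common point. -/
open scoped Classical

namespace TverbergCycle

variable {α : Type*}

/-- Two finite families that are completely related to each other can be arranged in an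
alternating path between two given endpoints, when they have the same size. -/
theorem exists_alternating_path {R : α → α → Prop} (X Y : List α) (hlen : X.length = Y.length)
    (hXY : ∀ x ∈ X, ∀ y ∈ Y, R x y ∧ R y x) (z w : α) (hz : ∀ x ∈ X, R z x)
    (hw : ∀ y ∈ Y, R y w) (hzw : R z w) :
    ∃ l : List α, l.Perm (X ++ Y) ∧ List.IsChain R (z :: (l ++ [w])) := by
  induction X generalizing Y z with
  | nil =>
    obtain rfl : Y = [] := List.length_eq_zero_iff.mp hlen.symm
    exact ⟨[], by simp, by simpa using hzw⟩
  | cons x X ih =>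
    cases Y with
    | nil => simp at hlen
    | cons y Y =>
      obtain ⟨l, hl, hc⟩ := ih Y (by simpa using hlen)
        (fun x' hx' y' hy' => hXY x' (by simp [hx']) y' (by simp [hy'])) y
        (fun x' hx' => (hXY x' (by simp [hx']) y (by simp)).2)
        (fun y' hy' => hw y' (by simp [hy'])) (hw y (by simp))
      refine ⟨x :: y :: l, ?_, ?_⟩
      · have h : (y :: l).Perm (X ++ y :: Y) := (hl.cons y).trans List.perm_middle.symm
        simpa using h.cons x
      · simp only [List.cons_append, List.isChain_cons_cons]
        exact ⟨hz x (by simp), (hXY x (by simp) y (by simp)).1, hc⟩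

/-- The variant of `exists_alternating_path` in which the first family has one more element. -/
theorem exists_alternating_path_succ {R : α → α → Prop} (X Y : List α)
    (hlen : X.length = Y.length + 1)
    (hXY : ∀ x ∈ X, ∀ y ∈ Y, R x y ∧ R y x) (z w : α) (hz : ∀ x ∈ X, R z x)
    (hw : ∀ x ∈ X, R x w) :
    ∃ l : List α, l.Perm (X ++ Y) ∧ List.IsChain R (z :: (l ++ [w])) := by
  cases X with
  | nil => simp at hlen
  | cons x X =>
    obtain ⟨l, hl, hc⟩ := exists_alternating_path Y X (by simpa using hlen.symm)
      (fun y hy x' hx' => (hXY x' (by simp [hx']) y hy).symm) x w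
      (fun y hy => (hXY x (by simp) y hy).1) (fun x' hx' => hw x' (by simp [hx']))
      (hw x (by simp))
    refine ⟨x :: l, ?_, ?_⟩
    · simpa using (hl.trans List.perm_append_comm).cons x
    · simp only [List.cons_append, List.isChain_cons_cons]
      exact ⟨hz x (by simp), hc⟩

/-- Two points, given by their coordinates, are seen from the origin at an angle that is at
least right. -/
def Obtuse (f g : α → ℝ) (p q : α) : Prop := f p * f q + g p * g q ≤ 0

theorem obtuse_of_signs {f g : α → ℝ} {x y : α}
    (hf : (0 ≤ f x ∧ f y ≤ 0) ∨ (f x ≤ 0 ∧ 0 ≤ f y))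
    (hg : (0 ≤ g x ∧ g y ≤ 0) ∨ (g x ≤ 0 ∧ 0 ≤ g y)) : Obtuse f g x y ∧ Obtuse f g y x := by
  have h₁ : f x * f y ≤ 0 := by
    rcases hf with h | h
    · exact mul_nonpos_of_nonneg_of_nonpos h.1 h.2
    · exact mul_nonpos_of_nonpos_of_nonneg h.1 h.2
  have h₂ : g x * g y ≤ 0 := by
    rcases hg with h | h
    · exact mul_nonpos_of_nonneg_of_nonpos h.1 h.2
    · exact mul_nonpos_of_nonpos_of_nonneg h.1 h.2
  unfold Obtuse
  constructor <;> linarith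

variable [DecidableEq α]

/-- `P` admits a Hamiltonian cycle whose consecutive vertices are related by `R`. -/
def HasCycle (R : α → α → Prop) (P : Finset α) : Prop :=
  ∃ (s : α) (l : List α), (s :: l).length = P.card ∧ (s :: l).toFinset = P ∧
    List.IsChain R (s :: (l ++ [s]))

theorem HasCycle.mono {R R' : α → α → Prop} {P : Finset α} (h : HasCycle R P)
    (hR : ∀ p q, R p q → R' p q) : HasCycle R' P := by
  obtain ⟨s, l, h₁, h₂, h₃⟩ := h
  exact ⟨s, l, h₁, h₂, h₃.imp hR⟩

theorem hasCycle_of_paths {R : α → α → Prop} {P X₁ Y₁ X₂ Y₂ : Finset α} {s t : α}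
    {l₁ l₂ : List α} (h₁ : l₁.Perm (X₁.toList ++ Y₁.toList))
    (h₂ : l₂.Perm (X₂.toList ++ Y₂.toList))
    (hc₁ : List.IsChain R (s :: (l₁ ++ [t]))) (hc₂ : List.IsChain R (t :: (l₂ ++ [s])))
    (hcard : P.card = X₁.card + Y₁.card + X₂.card + Y₂.card + 2)
    (hP : ∀ x, x ∈ P ↔ x = s ∨ x = t ∨ x ∈ X₁ ∨ x ∈ Y₁ ∨ x ∈ X₂ ∨ x ∈ Y₂) :
    HasCycle R P := by
  refine ⟨s, l₁ ++ t :: l₂, ?_, ?_, ?_⟩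
  · have := h₁.length_eq
    have := h₂.length_eq
    simp at *
    omega
  · ext x
    simp only [List.mem_toFinset, List.mem_cons, List.mem_append, h₁.mem_iff, h₂.mem_iff,
      Finset.mem_toList, hP]
    tauto
  · have := List.IsChain.append_overlap (l₁ := s :: l₁) (l₂ := [t]) (l₃ := l₂ ++ [s])
      (by simpa using hc₁) (by simpa using hc₂) (by simp)
    simpa using this

theorem card_eq_of_subset_union {X T C D : Finset α} (hX : X ⊆ T ∪ C ∪ D) (hTC : Disjoint T C)
    (hTD : Disjoint T D) (hCD : Disjoint C D) :
    X.card = (X ∩ T).card + (X ∩ C).card + (X ∩ D).card := by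
  rw [← Finset.card_union_of_disjoint, ← Finset.card_union_of_disjoint,
    ← Finset.inter_union_distrib_left, ← Finset.inter_union_distrib_left,
    Finset.inter_eq_left.mpr hX]
  · rw [← Finset.inter_union_distrib_left]
    exact (Finset.disjoint_union_left.mpr ⟨hTD, hCD⟩).mono Finset.inter_subset_right
      Finset.inter_subset_right
  · exact hTC.mono Finset.inter_subset_right Finset.inter_subset_right

/-- `T`, `C`, `D` partition `P`, with `C` and `D` of equal size, and the function `f`
vanishes on `T`, is nonnegative on `C` and nonpositive on `D`. -/
structure Balanced (f : α → ℝ) (P T C D : Finset α) : Prop where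
  union_eq : P = T ∪ C ∪ D
  disj₁ : Disjoint T C
  disj₂ : Disjoint T D
  disj₃ : Disjoint C D
  card_eq : C.card = D.card
  zero : ∀ x ∈ T, f x = 0
  nonneg : ∀ x ∈ C, 0 ≤ f x
  nonpos : ∀ x ∈ D, f x ≤ 0

theorem Balanced.neg {f : α → ℝ} {P T C D : Finset α} (h : Balanced f P T C D) :
    Balanced (-f) P T D C where
  union_eq := by rw [h.union_eq, Finset.union_right_comm]
  disj₁ := h.disj₂
  disj₂ := h.disj₁
  disj₃ := h.disj₃.symm
  card_eq := h.card_eq.symm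
  zero x hx := by simp [h.zero x hx]
  nonneg x hx := by simpa using h.nonpos x hx
  nonpos x hx := by simpa using h.nonneg x hx

theorem Balanced.card_inter {f : α → ℝ} {P T C D X : Finset α} (h : Balanced f P T C D)
    (hX : X ⊆ P) : X.card = (X ∩ T).card + (X ∩ C).card + (X ∩ D).card :=
  card_eq_of_subset_union (h.union_eq ▸ hX) h.disj₁ h.disj₂ h.disj₃

theorem Balanced.mem_iff {f : α → ℝ} {P T C D : Finset α} (h : Balanced f P T C D) (x : α) :
    x ∈ P ↔ x ∈ T ∨ x ∈ C ∨ x ∈ D := by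
  simp [h.union_eq]

/-- A point on the nonnegative first half-axis and a point on the nonnegative second
half-axis are joined by two alternating paths through opposite quadrants. -/
theorem hasCycle_odd_of_mem {f g : α → ℝ} {P N S E W : Finset α} {a d : α}
    (hg : Balanced g P {a} N S) (hf : Balanced f P {d} E W) (haE : a ∈ E) (hdN : d ∈ N) :
    HasCycle (Obtuse f g) P := by
  have hNP : N ⊆ P := fun x hx => (hg.mem_iff x).2 (by simp [hx])
  have hSP : S ⊆ P := fun x hx => (hg.mem_iff x).2 (by simp [hx])
  have hEP : E ⊆ P := fun x hx => (hf.mem_iff x).2 (by simp [hx])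
  have hWP : W ⊆ P := fun x hx => (hf.mem_iff x).2 (by simp [hx])
  have hdS : d ∉ S := fun h => Finset.disjoint_left.mp hg.disj₃ hdN h
  have haW : a ∉ W := fun h => Finset.disjoint_left.mp hf.disj₃ haE h
  have cN := hf.card_inter hNP
  have cS := hf.card_inter hSP
  have cE := hg.card_inter hEP
  have cW := hg.card_inter hWP
  have cP := hg.card_inter subset_rfl
  simp only [Finset.inter_singleton_of_mem hdN, Finset.inter_singleton_of_notMem hdS,
    Finset.inter_singleton_of_mem haE, Finset.inter_singleton_of_notMem haW,
    Finset.inter_singleton_of_mem ((hg.mem_iff a).2 (by simp)),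
    Finset.inter_eq_right.mpr hNP, Finset.inter_eq_right.mpr hSP,
    Finset.card_singleton, Finset.card_empty, Finset.inter_comm E, Finset.inter_comm W]
    at cN cS cE cW cP
  have := hf.card_eq
  have := hg.card_eq
  have ga := hg.zero a (by simp)
  have fd := hf.zero d (by simp)
  have fa := hf.nonneg a haE
  have gd := hg.nonneg d hdN
  have pN := hg.nonneg
  have pS := hg.nonpos
  have pE := hf.nonneg
  have pW := hf.nonpos
  obtain ⟨l₁, hl₁, hc₁⟩ := exists_alternating_path_succ (R := Obtuse f g)
    (S ∩ W).toList (N ∩ E).toList (by simp; omega)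
    (fun x hx y hy => by
      simp only [Finset.mem_toList, Finset.mem_inter] at hx hy
      exact obtuse_of_signs (.inr ⟨pW x hx.2, pE y hy.2⟩) (.inr ⟨pS x hx.1, pN y hy.1⟩)) a d
    (fun x hx => by
      simp only [Finset.mem_toList, Finset.mem_inter] at hx
      exact (obtuse_of_signs (.inr ⟨pW x hx.2, fa⟩) (.inr ⟨pS x hx.1, ga.ge⟩)).2)
    (fun x hx => by
      simp only [Finset.mem_toList, Finset.mem_inter] at hx
      exact (obtuse_of_signs (.inr ⟨pW x hx.2, fd.ge⟩) (.inr ⟨pS x hx.1, gd⟩)).1)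
  obtain ⟨l₂, hl₂, hc₂⟩ := exists_alternating_path (R := Obtuse f g)
    (S ∩ E).toList (N ∩ W).toList (by simp; omega)
    (fun x hx y hy => by
      simp only [Finset.mem_toList, Finset.mem_inter] at hx hy
      exact obtuse_of_signs (.inl ⟨pE x hx.2, pW y hy.2⟩) (.inr ⟨pS x hx.1, pN y hy.1⟩)) d a
    (fun x hx => by
      simp only [Finset.mem_toList, Finset.mem_inter] at hx
      exact (obtuse_of_signs (.inl ⟨pE x hx.2, fd.le⟩) (.inr ⟨pS x hx.1, gd⟩)).2)
    (fun x hx => by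
      simp only [Finset.mem_toList, Finset.mem_inter] at hx
      exact (obtuse_of_signs (.inr ⟨pW x hx.2, fa⟩) (.inl ⟨pN x hx.1, ga.le⟩)).1)
    (obtuse_of_signs (.inr ⟨fd.le, fa⟩) (.inl ⟨gd, ga.le⟩)).1
  refine hasCycle_of_paths hl₁ hl₂ hc₁ hc₂ (by omega) fun x => ?_
  have h₁ := hg.mem_iff x
  have h₂ := hf.mem_iff x
  have h₃ : x = a → x ∈ P := fun h => h ▸ hEP haE
  have h₄ : x = d → x ∈ P := fun h => h ▸ hNP hdN
  simp only [Finset.mem_inter, Finset.mem_singleton] at h₁ h₂ ⊢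
  clear * - h₁ h₂ h₃ h₄
  tauto

theorem hasCycle_odd {f g : α → ℝ} {P N S E W : Finset α} {a d : α} (had : a ≠ d)
    (hg : Balanced g P {a} N S) (hf : Balanced f P {d} E W) :
    HasCycle (Obtuse f g) P := by
  have ha : a ∈ E ∨ a ∈ W := by
    have := (hf.mem_iff a).1 ((hg.mem_iff a).2 (by simp))
    simpa [had] using this
  have hd : d ∈ N ∨ d ∈ S := by
    have := (hg.mem_iff d).1 ((hf.mem_iff d).2 (by simp))
    simpa [had.symm] using this
  rcases ha with ha | ha <;> rcases hd with hd | hd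
  · exact hasCycle_odd_of_mem hg hf ha hd
  · exact (hasCycle_odd_of_mem hg.neg hf ha hd).mono fun p q h => by simpa [Obtuse] using h
  · exact (hasCycle_odd_of_mem hg hf.neg ha hd).mono fun p q h => by simpa [Obtuse] using h
  · exact (hasCycle_odd_of_mem hg.neg hf.neg ha hd).mono
      fun p q h => by simpa [Obtuse] using h

/-- Cycle for an even set, both points of the first axis lying on the same half-axis. -/
theorem hasCycle_even_of_same {f g : α → ℝ} {P N S E W : Finset α} {a b : α} (hab : a ≠ b)
    (hg : Balanced g P {a, b} N S) (hf : Balanced f P ∅ E W) (haE : a ∈ E) (hbE : b ∈ E) :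
    HasCycle (Obtuse f g) P := by
  have hNP : N ⊆ P := fun x hx => (hg.mem_iff x).2 (by simp [hx])
  have hSP : S ⊆ P := fun x hx => (hg.mem_iff x).2 (by simp [hx])
  have hEP : E ⊆ P := fun x hx => (hf.mem_iff x).2 (by simp [hx])
  have hWP : W ⊆ P := fun x hx => (hf.mem_iff x).2 (by simp [hx])
  have haW : a ∉ W := fun h => Finset.disjoint_left.mp hf.disj₃ haE h
  have hbW : b ∉ W := fun h => Finset.disjoint_left.mp hf.disj₃ hbE h
  have cN := hf.card_inter hNP
  have cS := hf.card_inter hSP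
  have cE := hg.card_inter hEP
  have cW := hg.card_inter hWP
  have cP := hg.card_inter subset_rfl
  have e₁ : E ∩ {a, b} = {a, b} := by
    apply Finset.inter_eq_right.mpr; simp [Finset.insert_subset_iff, haE, hbE]
  have e₂ : W ∩ {a, b} = ∅ := by
    ext x; simp only [Finset.mem_inter, Finset.mem_insert, Finset.mem_singleton,
      Finset.notMem_empty, iff_false]
    rintro ⟨h, rfl | rfl⟩ <;> contradiction
  have e₃ : P ∩ {a, b} = {a, b} := by
    apply Finset.inter_eq_right.mpr; simp [Finset.insert_subset_iff, hEP haE, hEP hbE]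
  simp only [e₁, e₂, e₃, Finset.inter_empty, Finset.card_pair hab,
    Finset.inter_eq_right.mpr hNP, Finset.inter_eq_right.mpr hSP,
    Finset.card_empty, Finset.inter_comm E, Finset.inter_comm W]
    at cN cS cE cW cP
  have := hf.card_eq
  have := hg.card_eq
  have ga := hg.zero a (by simp)
  have gb := hg.zero b (by simp)
  have fa := hf.nonneg a haE
  have fb := hf.nonneg b hbE
  have pN := hg.nonneg
  have pS := hg.nonpos
  have pE := hf.nonneg
  have pW := hf.nonpos
  obtain ⟨l₁, hl₁, hc₁⟩ := exists_alternating_path_succ (R := Obtuse f g)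
    (S ∩ W).toList (N ∩ E).toList (by simp; omega)
    (fun x hx y hy => by
      simp only [Finset.mem_toList, Finset.mem_inter] at hx hy
      exact obtuse_of_signs (.inr ⟨pW x hx.2, pE y hy.2⟩) (.inr ⟨pS x hx.1, pN y hy.1⟩)) a b
    (fun x hx => by
      simp only [Finset.mem_toList, Finset.mem_inter] at hx
      exact (obtuse_of_signs (.inr ⟨pW x hx.2, fa⟩) (.inr ⟨pS x hx.1, ga.ge⟩)).2)
    (fun x hx => by
      simp only [Finset.mem_toList, Finset.mem_inter] at hx
      exact (obtuse_of_signs (.inr ⟨pW x hx.2, fb⟩) (.inr ⟨pS x hx.1, gb.ge⟩)).1)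
  obtain ⟨l₂, hl₂, hc₂⟩ := exists_alternating_path_succ (R := Obtuse f g)
    (N ∩ W).toList (S ∩ E).toList (by simp; omega)
    (fun x hx y hy => by
      simp only [Finset.mem_toList, Finset.mem_inter] at hx hy
      exact obtuse_of_signs (.inr ⟨pW x hx.2, pE y hy.2⟩) (.inl ⟨pN x hx.1, pS y hy.1⟩)) b a
    (fun x hx => by
      simp only [Finset.mem_toList, Finset.mem_inter] at hx
      exact (obtuse_of_signs (.inr ⟨pW x hx.2, fb⟩) (.inl ⟨pN x hx.1, gb.le⟩)).2)
    (fun x hx => by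
      simp only [Finset.mem_toList, Finset.mem_inter] at hx
      exact (obtuse_of_signs (.inr ⟨pW x hx.2, fa⟩) (.inl ⟨pN x hx.1, ga.le⟩)).1)
  refine hasCycle_of_paths hl₁ hl₂ hc₁ hc₂ (by omega) fun x => ?_
  have h₁ := hg.mem_iff x
  have h₂ := hf.mem_iff x
  have h₃ : x = a → x ∈ P := fun h => h ▸ hEP haE
  have h₄ : x = b → x ∈ P := fun h => h ▸ hEP hbE
  simp only [Finset.mem_inter, Finset.mem_singleton, Finset.mem_insert,
    Finset.notMem_empty] at h₁ h₂ ⊢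
  clear * - h₁ h₂ h₃ h₄
  tauto

/-- Cycle for an even set, the two points of the first axis lying on opposite half-axes. -/
theorem hasCycle_even_of_opposite {f g : α → ℝ} {P N S E W : Finset α} {a b : α} (hab : a ≠ b)
    (hg : Balanced g P {a, b} N S) (hf : Balanced f P ∅ E W) (haE : a ∈ E) (hbW : b ∈ W) :
    HasCycle (Obtuse f g) P := by
  have hNP : N ⊆ P := fun x hx => (hg.mem_iff x).2 (by simp [hx])
  have hSP : S ⊆ P := fun x hx => (hg.mem_iff x).2 (by simp [hx])
  have hEP : E ⊆ P := fun x hx => (hf.mem_iff x).2 (by simp [hx])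
  have hWP : W ⊆ P := fun x hx => (hf.mem_iff x).2 (by simp [hx])
  have haW : a ∉ W := fun h => Finset.disjoint_left.mp hf.disj₃ haE h
  have hbE : b ∉ E := fun h => Finset.disjoint_left.mp hf.disj₃ h hbW
  have cN := hf.card_inter hNP
  have cS := hf.card_inter hSP
  have cE := hg.card_inter hEP
  have cW := hg.card_inter hWP
  have cP := hg.card_inter subset_rfl
  have e₁ : E ∩ {a, b} = {a} := by
    rw [Finset.inter_insert_of_mem haE, Finset.inter_singleton_of_notMem hbE]; rfl
  have e₂ : W ∩ {a, b} = {b} := by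
    rw [Finset.inter_insert_of_notMem haW, Finset.inter_singleton_of_mem hbW]
  have e₃ : P ∩ {a, b} = {a, b} := by
    apply Finset.inter_eq_right.mpr; simp [Finset.insert_subset_iff, hEP haE, hWP hbW]
  simp only [e₁, e₂, e₃, Finset.inter_empty, Finset.card_pair hab, Finset.card_singleton,
    Finset.inter_eq_right.mpr hNP, Finset.inter_eq_right.mpr hSP,
    Finset.card_empty, Finset.inter_comm E, Finset.inter_comm W]
    at cN cS cE cW cP
  have := hf.card_eq
  have := hg.card_eq
  have ga := hg.zero a (by simp)
  have gb := hg.zero b (by simp)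
  have fa := hf.nonneg a haE
  have fb := hf.nonpos b hbW
  have pN := hg.nonneg
  have pS := hg.nonpos
  have pE := hf.nonneg
  have pW := hf.nonpos
  have hab' := obtuse_of_signs (f := f) (g := g) (.inl ⟨fa, fb⟩) (.inl ⟨ga.ge, gb.le⟩)
  obtain ⟨l₁, hl₁, hc₁⟩ := exists_alternating_path (R := Obtuse f g)
    (S ∩ W).toList (N ∩ E).toList (by simp; omega)
    (fun x hx y hy => by
      simp only [Finset.mem_toList, Finset.mem_inter] at hx hy
      exact obtuse_of_signs (.inr ⟨pW x hx.2, pE y hy.2⟩) (.inr ⟨pS x hx.1, pN y hy.1⟩)) a b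
    (fun x hx => by
      simp only [Finset.mem_toList, Finset.mem_inter] at hx
      exact (obtuse_of_signs (.inr ⟨pW x hx.2, fa⟩) (.inr ⟨pS x hx.1, ga.ge⟩)).2)
    (fun x hx => by
      simp only [Finset.mem_toList, Finset.mem_inter] at hx
      exact (obtuse_of_signs (.inl ⟨pE x hx.2, fb⟩) (.inl ⟨pN x hx.1, gb.le⟩)).1) hab'.1
  obtain ⟨l₂, hl₂, hc₂⟩ := exists_alternating_path (R := Obtuse f g)
    (S ∩ E).toList (N ∩ W).toList (by simp; omega)
    (fun x hx y hy => by
      simp only [Finset.mem_toList, Finset.mem_inter] at hx hy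
      exact obtuse_of_signs (.inl ⟨pE x hx.2, pW y hy.2⟩) (.inr ⟨pS x hx.1, pN y hy.1⟩)) b a
    (fun x hx => by
      simp only [Finset.mem_toList, Finset.mem_inter] at hx
      exact (obtuse_of_signs (.inl ⟨pE x hx.2, fb⟩) (.inr ⟨pS x hx.1, gb.ge⟩)).2)
    (fun x hx => by
      simp only [Finset.mem_toList, Finset.mem_inter] at hx
      exact (obtuse_of_signs (.inr ⟨pW x hx.2, fa⟩) (.inl ⟨pN x hx.1, ga.le⟩)).1) hab'.2
  refine hasCycle_of_paths hl₁ hl₂ hc₁ hc₂ (by omega) fun x => ?_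
  have h₁ := hg.mem_iff x
  have h₂ := hf.mem_iff x
  have h₃ : x = a → x ∈ P := fun h => h ▸ hEP haE
  have h₄ : x = b → x ∈ P := fun h => h ▸ hWP hbW
  simp only [Finset.mem_inter, Finset.mem_singleton, Finset.mem_insert,
    Finset.notMem_empty] at h₁ h₂ ⊢
  clear * - h₁ h₂ h₃ h₄
  tauto

theorem hasCycle_even {f g : α → ℝ} {P N S E W : Finset α} {a b : α} (hab : a ≠ b)
    (hg : Balanced g P {a, b} N S) (hf : Balanced f P ∅ E W) :
    HasCycle (Obtuse f g) P := by
  have ha : a ∈ E ∨ a ∈ W := by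
    simpa using (hf.mem_iff a).1 ((hg.mem_iff a).2 (by simp))
  have hb : b ∈ E ∨ b ∈ W := by
    simpa using (hf.mem_iff b).1 ((hg.mem_iff b).2 (by simp))
  rcases ha with ha | ha <;> rcases hb with hb | hb
  · exact hasCycle_even_of_same hab hg hf ha hb
  · exact hasCycle_even_of_opposite hab hg hf ha hb
  · exact hasCycle_even_of_opposite hab.symm (Finset.pair_comm a b ▸ hg) hf hb ha
  · exact (hasCycle_even_of_same hab hg hf.neg ha hb).mono fun p q h => by simpa [Obtuse] using h

/-- Selection of the element of given rank with respect to a key. -/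
theorem exists_rank_split {β : Type*} [LinearOrder β] (κ : α → β) (i j : ℕ) (P : Finset α)
    (hP : P.card = i + 1 + j) :
    ∃ (L U : Finset α) (t : α), L.card = i ∧ U.card = j ∧ P = insert t (L ∪ U) ∧
      t ∉ L ∧ t ∉ U ∧ Disjoint L U ∧ (∀ x ∈ L, κ x ≤ κ t) ∧ (∀ x ∈ U, κ t ≤ κ x) := by
  induction i generalizing P with
  | zero =>
    obtain ⟨t, ht, hmin⟩ := P.exists_min_image κ (Finset.card_pos.mp (by omega))
    refine ⟨∅, P.erase t, t, rfl, ?_, ?_, by simp, by simp, by simp, by simp, ?_⟩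
    · rw [Finset.card_erase_of_mem ht]; omega
    · simp [Finset.insert_erase ht]
    · intro x hx
      exact hmin x (Finset.mem_of_mem_erase hx)
  | succ i ih =>
    obtain ⟨s, hs, hmin⟩ := P.exists_min_image κ (Finset.card_pos.mp (by omega))
    obtain ⟨L, U, t, hL, hU, hPe, htL, htU, hd, h₁, h₂⟩ := ih (P.erase s)
      (by rw [Finset.card_erase_of_mem hs]; omega)
    have hsn : s ∉ insert t (L ∪ U) := hPe ▸ Finset.notMem_erase s P
    simp only [Finset.mem_insert, Finset.mem_union, not_or] at hsn
    have htP : t ∈ P := Finset.mem_of_mem_erase (hPe ▸ Finset.mem_insert_self _ _)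
    refine ⟨insert s L, U, t, ?_, hU, ?_, ?_, htU, ?_, ?_, h₂⟩
    · rw [Finset.card_insert_of_notMem hsn.2.1, hL]
    · rw [← Finset.insert_erase hs, hPe]
      ext x; simp; tauto
    · simp only [Finset.mem_insert, not_or]
      exact ⟨fun h => hsn.1 h.symm, htL⟩
    · rw [Finset.disjoint_insert_left]; exact ⟨hsn.2.2, hd⟩
    · intro x hx
      rcases Finset.mem_insert.mp hx with rfl | hx
      · exact hmin t htP
      · exact h₁ x hx

/-- The Euclidean plane. -/
abbrev Plane := EuclideanSpace ℝ (Fin 2)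

/-- The slope of a vector of the closed right half-plane, infinite on vertical vectors. -/
noncomputable def slopeKey (x y : ℝ) : WithTop ℝ := if x = 0 then ⊤ else ((y / x : ℝ) : WithTop ℝ)

theorem cross_nonneg_of_slopeKey_le {x y x' y' : ℝ} (h : 0 < x ∨ (x = 0 ∧ 0 < y))
    (h' : 0 < x' ∨ (x' = 0 ∧ 0 < y')) (hk : slopeKey x y ≤ slopeKey x' y') :
    0 ≤ x * y' - y * x' := by
  unfold slopeKey at hk
  rcases h' with h' | ⟨rfl, h'⟩
  · rcases h with h | ⟨rfl, h⟩
    · rw [if_neg h.ne', if_neg h'.ne', WithTop.coe_le_coe, div_le_div_iff₀ h h'] at hk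
      linarith
    · rw [if_pos rfl, if_neg h'.ne'] at hk
      simp at hk
  · have : 0 ≤ x := by rcases h with h | h <;> linarith
    nlinarith

/-- The signed area spanned by `b - a` and `p - a`. -/
def cross (a b p : Plane) : ℝ := (b 0 - a 0) * (p 1 - a 1) - (b 1 - a 1) * (p 0 - a 0)

/-- The line through two suitable points splits the remaining ones in prescribed sizes. -/
theorem exists_splitting_line (P : Finset Plane) (i j : ℕ) (hP : P.card = i + j + 2) :
    ∃ (a b : Plane) (S N : Finset Plane), a ≠ b ∧ S.card = i ∧ N.card = j ∧
      P = {a, b} ∪ N ∪ S ∧ a ∉ N ∧ a ∉ S ∧ b ∉ N ∧ b ∉ S ∧ Disjoint N S ∧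
      (∀ x ∈ N, 0 ≤ cross a b x) ∧ (∀ x ∈ S, cross a b x ≤ 0) := by
  obtain ⟨a, ha, hmin⟩ := P.exists_min_image (fun p : Plane => toLex (p 0, p 1))
    (Finset.card_pos.mp (by omega))
  obtain ⟨S, N, b, hS, hN, hPe, hbS, hbN, hd, h₁, h₂⟩ :=
    exists_rank_split (fun p : Plane => slopeKey (p 0 - a 0) (p 1 - a 1)) i j (P.erase a)
      (by rw [Finset.card_erase_of_mem ha]; omega)
  have hpos : ∀ x ∈ P.erase a, 0 < x 0 - a 0 ∨ (x 0 - a 0 = 0 ∧ 0 < x 1 - a 1) := by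
    intro x hx
    have hne := Finset.ne_of_mem_erase hx
    have := hmin x (Finset.mem_of_mem_erase hx)
    rw [Prod.Lex.toLex_le_toLex] at this
    rcases this with h | ⟨h, h'⟩
    · left; simpa using h
    · right
      simp only at h h'
      refine ⟨by linarith, sub_pos.mpr (lt_of_le_of_ne h' fun h'' => hne ?_)⟩
      ext k; fin_cases k
      · exact h.symm
      · exact h''.symm
  have han : a ∉ insert b (S ∪ N) := by rw [← hPe]; exact Finset.notMem_erase a P
  have hbp := hpos b (by rw [hPe]; simp)
  have hSp : ∀ x ∈ S, 0 < x 0 - a 0 ∨ (x 0 - a 0 = 0 ∧ 0 < x 1 - a 1) :=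
    fun x hx => hpos x (by rw [hPe]; simp [hx])
  have hNp : ∀ x ∈ N, 0 < x 0 - a 0 ∨ (x 0 - a 0 = 0 ∧ 0 < x 1 - a 1) :=
    fun x hx => hpos x (by rw [hPe]; simp [hx])
  simp only [Finset.mem_insert, Finset.mem_union, not_or] at han
  refine ⟨a, b, S, N, han.1, hS, hN, ?_, han.2.2, han.2.1, hbN, hbS, hd.symm, ?_, ?_⟩
  · rw [← Finset.insert_erase ha, hPe]
    ext x; simp; tauto
  · intro x hx
    exact cross_nonneg_of_slopeKey_le hbp (hNp x hx) (h₂ x hx)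
  · intro x hx
    have := cross_nonneg_of_slopeKey_le (hSp x hx) hbp (h₁ x hx)
    unfold cross
    linarith

/-- The scalar product of `b - a` and `p - d`. -/
def along (a b d p : Plane) : ℝ := (b 0 - a 0) * (p 0 - d 0) + (b 1 - a 1) * (p 1 - d 1)

theorem exists_hasCycle (P : Finset Plane) (hP : 3 ≤ P.card) :
    ∃ a b d : Plane, a ≠ b ∧ HasCycle (Obtuse (along a b d) (cross a b)) P := by
  have hla : ∀ a b : Plane, cross a b a = 0 := fun a b => by simp [cross]
  have hlb : ∀ a b : Plane, cross a b b = 0 := fun a b => by simp [cross]; ring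
  have hld : ∀ a b d : Plane, along a b d d = 0 := fun a b d => by simp [along]
  have hmono : ∀ a b d p : Plane, along a b d p = along a b 0 p - along a b 0 d :=
    fun a b d p => by simp [along]; ring
  rcases Nat.even_or_odd' P.card with ⟨k, hk | hk⟩
  · obtain ⟨a, b, S, N, hab, hS, hN, hPe, haN, haS, hbN, hbS, hd, h₁, h₂⟩ :=
      exists_splitting_line P (k - 1) (k - 1) (by omega)
    obtain ⟨W, E, d, hW, hE, hPe', hdW, hdE, hWE, h₃, h₄⟩ :=
      exists_rank_split (along a b 0) (k - 1) k P (by omega)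
    refine ⟨a, b, d, hab, hasCycle_even (N := N) (S := S) (E := E) (W := insert d W) hab ?_ ?_⟩
    · refine ⟨hPe, by simp [haN, hbN], by simp [haS, hbS], hd, by omega, ?_, h₁, h₂⟩
      intro x hx
      simp only [Finset.mem_insert, Finset.mem_singleton] at hx
      rcases hx with rfl | rfl
      · exact hla _ _
      · exact hlb _ _
    · refine ⟨?_, by simp, by simp, ?_, ?_, by simp, ?_, ?_⟩
      · rw [hPe']; ext x; simp; tauto
      · rw [Finset.disjoint_insert_right]; exact ⟨hdE, hWE.symm⟩
      · rw [Finset.card_insert_of_notMem hdW]; omega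
      · intro x hx
        rw [hmono]; linarith [h₄ x hx]
      · intro x hx
        rcases Finset.mem_insert.mp hx with rfl | hx
        · exact (hld _ _ _).le
        · rw [hmono]; linarith [h₃ x hx]
  · obtain ⟨a, b, S, N, hab, hS, hN, hPe, haN, haS, hbN, hbS, hd, h₁, h₂⟩ :=
      exists_splitting_line P (k - 1) k (by omega)
    obtain ⟨W, E, d, hW, hE, hPe', hdW, hdE, hWE, h₃, h₄⟩ :=
      exists_rank_split (along a b 0) k k P (by omega)
    refine ⟨a, b, d, hab, ?_⟩
    have hf : Balanced (along a b d) P {d} E W := by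
      refine ⟨?_, by simpa using hdE, by simpa using hdW, hWE.symm, by omega, ?_, ?_, ?_⟩
      · rw [hPe']; ext x; simp; tauto
      · simp [hld]
      · intro x hx
        rw [hmono]; linarith [h₄ x hx]
      · intro x hx
        rw [hmono]; linarith [h₃ x hx]
    -- Either of `a`, `b` may play the role of the marked point, so take one distinct from `d`.
    by_cases had : a = d
    · refine hasCycle_odd (a := b) (N := N) (S := insert a S) (fun h => hab (had.trans h.symm))
        ⟨?_, by simpa using hbN, by simp [hab.symm, hbS], ?_, ?_, by simp [hlb], h₁, ?_⟩ hf
      · rw [hPe]; ext x; simp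
      · rw [Finset.disjoint_insert_right]; exact ⟨haN, hd⟩
      · rw [Finset.card_insert_of_notMem haS]; omega
      · intro x hx
        rcases Finset.mem_insert.mp hx with rfl | hx
        · exact (hla _ _).le
        · exact h₂ x hx
    · refine hasCycle_odd (a := a) (N := N) (S := insert b S) had
        ⟨?_, by simpa using haN, by simp [hab, haS], ?_, ?_, by simp [hla], h₁, ?_⟩ hf
      · rw [hPe]; ext x; simp; tauto
      · rw [Finset.disjoint_insert_right]; exact ⟨hbN, hd⟩
      · rw [Finset.card_insert_of_notMem hbS]; omega
      · intro x hx
        rcases Finset.mem_insert.mp hx with rfl | hx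
        · exact (hlb _ _).le
        · exact h₂ x hx

theorem dist_midpoint_le_of_coord {c p q : Plane}
    (h : (p 0 - c 0) * (q 0 - c 0) + (p 1 - c 1) * (q 1 - c 1) ≤ 0) :
    dist c (midpoint ℝ p q) ≤ dist p q / 2 := by
  have hm : ∀ k, (midpoint ℝ p q) k = (p k + q k) / 2 := fun k => by
    simp [midpoint_eq_smul_add]; ring
  rw [EuclideanSpace.dist_eq, EuclideanSpace.dist_eq, Fin.sum_univ_two, Fin.sum_univ_two]
  simp only [Real.dist_eq, sq_abs, hm]
  apply Real.sqrt_le_iff.mpr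
  refine ⟨by positivity, ?_⟩
  rw [div_pow, Real.sq_sqrt (by positivity)]
  nlinarith

/-- Points that are obtuse in the orthogonal coordinates `along a b d` and `cross a b` have a
diametral disk containing the origin of these coordinates. -/
theorem exists_center {a b : Plane} (d : Plane) (hab : a ≠ b) :
    ∃ c : Plane, ∀ p q, Obtuse (along a b d) (cross a b) p q →
      dist c (midpoint ℝ p q) ≤ dist p q / 2 := by
  obtain ⟨u, hu⟩ : ∃ u, u = b 0 - a 0 := ⟨_, rfl⟩
  obtain ⟨v, hv⟩ : ∃ v, v = b 1 - a 1 := ⟨_, rfl⟩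
  have hpos : 0 < u ^ 2 + v ^ 2 := by
    by_contra hcon
    have h0 : u = 0 := by nlinarith [sq_nonneg u, sq_nonneg v]
    have h1 : v = 0 := by nlinarith [sq_nonneg u, sq_nonneg v]
    apply hab
    ext k; fin_cases k
    · change a 0 = b 0
      linarith
    · change a 1 = b 1
      linarith
  obtain ⟨t, ht⟩ : ∃ t, t * (u ^ 2 + v ^ 2) = u * (d 0 - a 0) + v * (d 1 - a 1) :=
    ⟨_, div_mul_cancel₀ _ hpos.ne'⟩
  refine ⟨!₂[a 0 + t * u, a 1 + t * v], fun p q h => dist_midpoint_le_of_coord ?_⟩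
  have hal : ∀ p : Plane, along a b d p = u * (p 0 - (a 0 + t * u)) + v * (p 1 - (a 1 + t * v)) :=
    fun p => by
      simp only [along, ← hu, ← hv]
      linear_combination ht
  have hcr : ∀ p : Plane, cross a b p = u * (p 1 - (a 1 + t * v)) - v * (p 0 - (a 0 + t * u)) :=
    fun p => by
      simp only [cross, ← hu, ← hv]
      ring
  simp only [Obtuse, hal, hcr] at h
  simp only [Matrix.cons_val_zero, Matrix.cons_val_one]
  refine nonpos_of_mul_nonpos_right (a := u ^ 2 + v ^ 2) ?_ hpos
  linarith

theorem HasCycle.exists_fin {R : α → α → Prop} {P : Finset α} (h : HasCycle R P) {n : ℕ}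
    (hP : P.card = n + 1) :
    ∃ p : Fin (n + 1) → α, Function.Injective p ∧ Finset.image p Finset.univ = P ∧
      ∀ i, R (p i) (p (i + 1)) := by
  obtain ⟨s, l, hlen, hfin, hc⟩ := h
  have hl : l.length = n := by simpa [hP] using hlen
  subst hl
  have himg : Finset.image (s :: l).get Finset.univ = P := by
    rw [← hfin]
    ext x
    simp only [Finset.mem_image, Finset.mem_univ, true_and, List.mem_toFinset, List.mem_iff_get]
  refine ⟨(s :: l).get, ?_, himg, ?_⟩
  · have : Finset.card (Finset.image (s :: l).get Finset.univ) =
        (Finset.univ : Finset (Fin (l.length + 1))).card := by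
      rw [himg, hP]; simp
    exact fun x y hxy => Finset.card_image_iff.mp this (by simp) (by simp) hxy
  · intro i
    rw [List.isChain_iff_getElem] at hc
    have hi := hc i.1 (by simp; omega)
    have h₁ : (s :: (l ++ [s]))[i.1]'(by simp) = (s :: l).get i := by
      exact List.getElem_append_left (as := s :: l) (bs := [s]) i.2
    rw [h₁] at hi
    induction i using Fin.lastCases with
    | last =>
      simp only [Fin.last_add_one]
      simpa using hi
    | cast j =>
      rw [Fin.coeSucc_eq_succ]
      simpa using hi

end TverbergCycle

/-- **Tverberg Hamiltonian cycles in the plane** (Pirahmad, Polyanskii, Vasilevskii).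
For any finite set `P` of `n ≥ 3` points in the Euclidean plane (here `n = m + 3`),
there exists a cyclic ordering `p 0, p 1, …, p (n-1)` of the points of `P` (indices
modulo `n`) such that the `n` diametral disks induced by consecutive points have a
common point `c`: a point whose distance to each midpoint of `p i` and `p (i+1)` is at
most `dist (p i) (p (i+1)) / 2`. -/
theorem tverberg_hamiltonian_cycle_plane
    (m : ℕ) (P : Finset (EuclideanSpace ℝ (Fin 2))) (hP : P.card = m + 3) :
    ∃ p : Fin (m + 3) → EuclideanSpace ℝ (Fin 2),
      Function.Injective p ∧
      Finset.image p Finset.univ = P ∧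
      ∃ c : EuclideanSpace ℝ (Fin 2),
        ∀ i : Fin (m + 3),
          dist c (midpoint ℝ (p i) (p (i + 1))) ≤ dist (p i) (p (i + 1)) / 2 := by
  obtain ⟨a, b, d, hab, hcyc⟩ := TverbergCycle.exists_hasCycle P (by omega)
  obtain ⟨c, hc⟩ := TverbergCycle.exists_center d hab
  obtain ⟨p, hinj, himg, hp⟩ := hcyc.exists_fin (n := m + 2) hP
  exact ⟨p, hinj, himg, c, fun i => hc _ _ (hp i)⟩
end

section
/- Let P be a finite set of at least two points in a real inner product space, and let T be a spanning tree on vertex set P that maximizes the sum of the distances ‖x − y‖ over its edges, among all spanning trees on P. Then the diametral balls B(xy) induced by the edges {x, y} of T have a common point. -/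
open scoped Classical

namespace SimpleGraph

variable {V : Type*} {H : SimpleGraph V}

/-- Deleting an edge of a tree leaves two components, and any edge between them restores a tree. -/
theorem IsTree.exists_exchange {G : SimpleGraph V} (hG : G.IsTree) {a b : V} (hab : G.Adj a b) :
    ∃ (H : SimpleGraph V) (s : Set V), a ∈ s ∧ b ∉ s ∧ H ⊔ edge a b = G ∧
      ∀ x ∈ s, ∀ y ∉ s, ¬ H.Adj x y ∧ (H ⊔ edge x y).IsTree := by
  set H := G.deleteEdges {s(a, b)} with hH
  have hbridge : ¬ H.Reachable a b :=
    isBridge_iff.1 (isAcyclic_iff_forall_isBridge.1 hG.isAcyclic hab)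
  have hcover (v : V) : H.Reachable v a ∨ H.Reachable v b := by
    obtain ⟨p⟩ := hG.connected.preconnected v a
    induction p with
    | nil => exact Or.inl .rfl
    | @cons u v w huv _ ih =>
      by_cases he : s(u, v) = s(w, b)
      · rcases Sym2.eq_iff.1 he with ⟨rfl, -⟩ | ⟨rfl, -⟩
        · exact Or.inl .rfl
        · exact Or.inr .rfl
      · have hadj : H.Adj u v := by simp [hH, deleteEdges_adj, huv, he]
        exact (ih hab hH hbridge).imp hadj.reachable.trans hadj.reachable.trans
  refine ⟨H, {v | H.Reachable v a}, .rfl, fun h => hbridge h.symm, ?_, fun x hx y hy => ?_⟩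
  · ext u v
    simp only [hH, sup_adj, deleteEdges_adj, Set.mem_singleton_iff, edge_adj, Sym2.eq_iff]
    grind [G.ne_of_adj, G.adj_comm]
  · have hxy : ¬ H.Reachable x y := fun h => hy (h.symm.trans hx)
    refine ⟨fun h => hxy h.reachable, ?_, ?_⟩
    · have hle : H ≤ H ⊔ edge x y := le_sup_left
      have hadj : (H ⊔ edge x y).Adj y x :=
        (sup_adj ..).2 (Or.inr ((edge_adj ..).2 ⟨Or.inr ⟨rfl, rfl⟩, fun h => hxy (h ▸ .rfl)⟩))
      have hyb := (hcover y).resolve_left hy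
      refine (connected_iff_exists_forall_reachable _).2 ⟨a, fun v => Reachable.symm ?_⟩
      rcases hcover v with h | h
      · exact h.mono hle
      · exact ((h.trans hyb.symm).mono hle).trans
          (hadj.reachable.trans (Reachable.mono hle hx))
    · exact (isAcyclic_add_edge_iff_of_not_reachable x y hxy).2
        (hG.isAcyclic.anti (deleteEdges_le _))

theorem sum_sum_ite_adj_of_eq_sup_edge [Fintype V] {G : SimpleGraph V} (d : V → V → ℝ)
    (hd : ∀ x y, d x y = d y x) {x y : V} (hne : x ≠ y) (hxy : ¬ H.Adj x y)
    (hG : G = H ⊔ edge x y) :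
    (∑ i, ∑ j, if G.Adj i j then d i j else 0) =
      (∑ i, ∑ j, if H.Adj i j then d i j else 0) + 2 * d x y := by
  have hpt (i j : V) : (if G.Adj i j then d i j else 0) =
      (if H.Adj i j then d i j else 0) + (if i = x then if j = y then d i j else 0 else 0) +
        (if i = y then if j = x then d i j else 0 else 0) := by
    have hyx : ¬ H.Adj y x := fun h => hxy h.symm
    simp only [hG, sup_adj, edge_adj]
    by_cases hx : i = x <;> by_cases hy : j = y <;> by_cases hx' : i = y <;>
      by_cases hy' : j = x <;> simp_all
  simp only [hpt, Finset.sum_add_distrib]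
  simp [Finset.sum_ite_irrel, hd y x]
  ring

end SimpleGraph

section

variable {E : Type*} [NormedAddCommGroup E] [InnerProductSpace ℝ E]

/-- The center `c` of the smallest ball enclosing finitely many points is a convex combination of
those of the points that lie on its boundary sphere. -/
theorem exists_center_enclosing_ball {ι : Type*} [Fintype ι] [Nonempty ι] (p : ι → E) :
    ∃ (w : ι → ℝ) (c : E) (r : ℝ), (∀ i, 0 ≤ w i) ∧ ∑ i, w i = 1 ∧ ∑ i, w i • (p i - c) = 0 ∧
      (∀ i, ‖p i - c‖ ^ 2 ≤ r) ∧ ∀ i, w i ≠ 0 → ‖p i - c‖ ^ 2 = r := by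
  -- The weights maximize the variance of the distribution they define on the points.
  obtain ⟨w, ⟨hw0, hw1⟩, hmax⟩ := (isCompact_stdSimplex ℝ ι).exists_isMaxOn
    ⟨_, single_mem_stdSimplex ℝ (Classical.arbitrary ι)⟩
    (f := fun w => ∑ i, w i * ‖p i‖ ^ 2 - ‖∑ i, w i • p i‖ ^ 2) (by fun_prop)
  set c := ∑ i, w i • p i with hc
  set A := ∑ i, w i * ‖p i‖ ^ 2 with hA
  have hsq (i : ι) : ‖p i - c‖ ^ 2 = ‖p i‖ ^ 2 - 2 * inner ℝ (p i) c + ‖c‖ ^ 2 :=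
    norm_sub_sq_real _ _
  have hle (i : ι) : ‖p i - c‖ ^ 2 ≤ A - ‖c‖ ^ 2 := by
    have key (t : ℝ) (ht0 : 0 < t) (ht1 : t < 1) :
        ‖p i - c‖ ^ 2 ≤ A - ‖c‖ ^ 2 + t * ‖p i - c‖ ^ 2 := by
      have hmem := convex_stdSimplex ℝ ι ⟨hw0, hw1⟩ (single_mem_stdSimplex ℝ i)
        (sub_nonneg.2 ht1.le) ht0.le (sub_add_cancel 1 t)
      have hmix := isMaxOn_iff.1 hmax _ hmem
      have h1 : ∑ j, ((1 - t) • w + t • Pi.single i 1 : ι → ℝ) j * ‖p j‖ ^ 2 =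
          (1 - t) * A + t * ‖p i‖ ^ 2 := by
        simp [add_mul, Finset.sum_add_distrib, hA, Finset.mul_sum, mul_assoc, Pi.single_apply]
      have h2 : ∑ j, ((1 - t) • w + t • Pi.single i 1 : ι → ℝ) j • p j =
          c + t • (p i - c) := by
        simp only [Pi.add_apply, Pi.smul_apply, smul_eq_mul, add_smul, mul_smul,
          Finset.sum_add_distrib, ← Finset.smul_sum, ← hc]
        simp only [Pi.single_apply, ite_smul, one_smul, zero_smul, Finset.sum_ite_eq',
          Finset.mem_univ, if_true]
        module
      have h3 : ‖c + t • (p i - c)‖ ^ 2 =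
          ‖c‖ ^ 2 + 2 * t * (inner ℝ (p i) c - ‖c‖ ^ 2) + t ^ 2 * ‖p i - c‖ ^ 2 := by
        rw [norm_add_sq_real, norm_smul, mul_pow, inner_smul_right, inner_sub_right,
          real_inner_self_eq_norm_sq, real_inner_comm, Real.norm_eq_abs, sq_abs]
        ring
      simp only [h1, h2, h3, ← hA, ← hc] at hmix
      have := hsq i
      refine le_of_mul_le_mul_left ?_ ht0
      nlinarith
    refine le_of_forall_pos_lt_add fun ε hε => ?_
    set D := ‖p i - c‖ ^ 2
    have hD : 0 ≤ D := sq_nonneg _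
    have hpos : 0 < D + ε + 1 := by positivity
    have ht1 : ε / (D + ε + 1) < 1 := by rw [div_lt_one hpos]; linarith
    have hlt : ε / (D + ε + 1) * D < ε := by
      rw [div_mul_eq_mul_div, div_lt_iff₀ hpos]
      nlinarith
    linarith [key _ (by positivity) ht1]
  have hsum : ∑ i, w i * (A - ‖c‖ ^ 2 - ‖p i - c‖ ^ 2) = 0 := by
    have hinner : ∑ i, w i * inner ℝ (p i) c = ‖c‖ ^ 2 := by
      rw [← real_inner_self_eq_norm_sq]
      nth_rw 2 [hc]
      simp [sum_inner, inner_smul_left]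
    have hexp (i : ι) : w i * (A - ‖c‖ ^ 2 - ‖p i - c‖ ^ 2) =
        w i * (A - 2 * ‖c‖ ^ 2) - w i * ‖p i‖ ^ 2 + 2 * (w i * inner ℝ (p i) c) := by
      rw [hsq]; ring
    simp only [hexp, Finset.sum_add_distrib, Finset.sum_sub_distrib, ← Finset.sum_mul,
      ← Finset.mul_sum, hw1, hinner, ← hA]
    ring
  refine ⟨w, c, A - ‖c‖ ^ 2, hw0, hw1, ?_, hle, fun i hi => ?_⟩
  · simp [smul_sub, Finset.sum_sub_distrib, ← Finset.sum_smul, hw1, ← hc]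
  · have h := (Finset.sum_eq_zero_iff_of_nonneg fun i _ =>
      mul_nonneg (hw0 i) (sub_nonneg.2 (hle i))).1 hsum i (Finset.mem_univ i)
    linarith [(mul_eq_zero.1 h).resolve_left hi]

/-- If `0` is a convex combination of vectors of maximal norm and the indices are split into two
classes such that `u a`, `u b` realize the largest distance between the classes, then the angle
between `u a` and `u b` is not acute. -/
theorem inner_nonpos_of_forall_dist_le {ι : Type*} [Fintype ι] {w : ι → ℝ} {u : ι → E} {r : ℝ}
    (hw0 : ∀ i, 0 ≤ w i) (hw1 : ∑ i, w i = 1) (hu : ∑ i, w i • u i = 0)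
    (hle : ∀ i, ‖u i‖ ^ 2 ≤ r) (heq : ∀ i, w i ≠ 0 → ‖u i‖ ^ 2 = r) {s : Set ι} {a b : ι}
    (ha : a ∈ s) (hb : b ∉ s) (hs : ∀ x ∈ s, ∀ y ∉ s, ‖u x - u y‖ ≤ ‖u a - u b‖) :
    inner ℝ (u a) (u b) ≤ 0 := by
  by_contra! hpos
  have hsq (x : ι) (hx : x ∈ s) (y : ι) (hy : y ∉ s) :
      ‖u x‖ ^ 2 - 2 * inner ℝ (u x) (u y) + ‖u y‖ ^ 2 < ‖u a‖ ^ 2 + ‖u b‖ ^ 2 := by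
    have h := pow_le_pow_left₀ (norm_nonneg _) (hs x hx y hy) 2
    rw [norm_sub_sq_real, norm_sub_sq_real] at h
    linarith
  have hxb (x : ι) (hx : x ∈ s) (hwx : w x ≠ 0) : 0 < inner ℝ (u x) (u b) := by
    linarith [hsq x hx b hb, heq x hwx, hle a]
  have hya (y : ι) (hy : y ∉ s) (hwy : w y ≠ 0) : 0 < inner ℝ (u y) (u a) := by
    rw [real_inner_comm]
    linarith [hsq a ha y hy, heq y hwy, hle b]
  have hxy (x : ι) (hx : x ∈ s) (y : ι) (hy : y ∉ s) :
      0 ≤ w x * (w y * inner ℝ (u x) (u y)) := by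
    rcases eq_or_ne (w x) 0 with h | hwx
    · simp [h]
    rcases eq_or_ne (w y) 0 with h | hwy
    · simp [h]
    have := hsq x hx y hy
    exact mul_nonneg (hw0 x) (mul_nonneg (hw0 y)
      (by linarith [heq x hwx, heq y hwy, hle a, hle b]))
  have hzero (t : Finset ι) (v : E) (ht : ∑ i ∈ t, w i • u i = 0)
      (hv : ∀ i ∈ t, w i ≠ 0 → 0 < inner ℝ (u i) v) (i : ι) (hi : i ∈ t) : w i = 0 := by
    have hsum : ∑ i ∈ t, w i * inner ℝ (u i) v = 0 := by
      simpa [sum_inner, inner_smul_left] using congrArg (inner ℝ · v) ht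
    have hnn (i : ι) (hi : i ∈ t) : 0 ≤ w i * inner ℝ (u i) v := by
      rcases eq_or_ne (w i) 0 with h | h
      · simp [h]
      · exact mul_nonneg (hw0 i) (hv i hi h).le
    by_contra h
    exact (mul_ne_zero h (hv i hi h).ne') ((Finset.sum_eq_zero_iff_of_nonneg hnn).1 hsum i hi)
  have hsplit := Finset.sum_filter_add_sum_filter_not Finset.univ (· ∈ s) fun i => w i • u i
  rw [hu] at hsplit
  set X := ∑ i with i ∈ s, w i • u i with hX
  set Y := ∑ i with i ∉ s, w i • u i with hY
  have hXY : 0 ≤ inner ℝ X Y := by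
    simp only [hX, hY, sum_inner, inner_sum, real_inner_smul_left, real_inner_smul_right]
    refine Finset.sum_nonneg fun y hy => Finset.sum_nonneg fun x hx => ?_
    rw [mul_left_comm]
    exact hxy _ (Finset.mem_filter.1 hx).2 _ (Finset.mem_filter.1 hy).2
  have hYX : Y = -X := (neg_eq_of_add_eq_zero_right hsplit).symm
  have hX0 : X = 0 := by
    rw [hYX, inner_neg_right] at hXY
    exact real_inner_self_nonpos.1 (by simpa using hXY)
  have hw (i : ι) : w i = 0 := by
    by_cases hi : i ∈ s
    · exact hzero _ (u b) hX0 (fun x hx => hxb x (Finset.mem_filter.1 hx).2) i (by simp [hi])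
    · exact hzero _ (u a) (hYX.trans (by simp [hX0]))
        (fun y hy => hya y (Finset.mem_filter.1 hy).2) i (by simp [hi])
  simp [hw] at hw1

theorem dist_midpoint_le_of_inner_nonpos {a b c : E} (h : inner ℝ (a - c) (b - c) ≤ 0) :
    dist c (midpoint ℝ a b) ≤ dist a b / 2 := by
  have hmid : c - midpoint ℝ a b = -(2⁻¹ : ℝ) • ((a - c) + (b - c)) := by
    rw [midpoint_eq_smul_add, invOf_eq_inv]
    module
  have hle : ‖(a - c) + (b - c)‖ ≤ ‖(a - c) - (b - c)‖ := by
    refine le_of_sq_le_sq ?_ (norm_nonneg _)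
    rw [norm_add_sq_real, norm_sub_sq_real (a - c)]
    linarith
  rw [sub_sub_sub_cancel_right] at hle
  rw [dist_eq_norm, dist_eq_norm, hmid, norm_smul, norm_neg, norm_inv, Real.norm_ofNat]
  linarith

end

/-- **Max-sum spanning trees are Tverberg graphs** (Abu-Affash et al.;
Barabanshchikova, Polyanskii). Let `P` be a finite set of at least two points in a
real inner product space and let `G` be a spanning tree on `P` maximizing the sum of
the distances between the endpoints of its edges among all spanning trees on `P`
(here each edge is counted twice via the adjacency relation, which does not affect
maximality). Then the diametral balls induced by the edges of `G` have a common point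
`c`: a point whose distance to the midpoint of any edge `{x, y}` is at most
`dist x y / 2`. -/
theorem max_sum_spanning_tree_is_tverberg
    {E : Type*} [NormedAddCommGroup E] [InnerProductSpace ℝ E]
    (P : Finset E) (hP : 2 ≤ P.card)
    (G : SimpleGraph ↥P) (hG : G.IsTree)
    (hmax : ∀ G' : SimpleGraph ↥P, G'.IsTree →
      (∑ x : ↥P, ∑ y : ↥P, if G'.Adj x y then dist (x : E) (y : E) else 0) ≤
      (∑ x : ↥P, ∑ y : ↥P, if G.Adj x y then dist (x : E) (y : E) else 0)) :
    ∃ c : E, ∀ x y : ↥P, G.Adj x y →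
      dist c (midpoint ℝ (x : E) (y : E)) ≤ dist (x : E) (y : E) / 2 := by
  have : Nonempty ↥P := hG.connected.nonempty
  obtain ⟨w, c, r, hw0, hw1, hu, hle, heq⟩ := exists_center_enclosing_ball fun x : ↥P => (x : E)
  refine ⟨c, fun a b hab => dist_midpoint_le_of_inner_nonpos ?_⟩
  obtain ⟨H, s, ha, hb, hHG, hH⟩ := hG.exists_exchange hab
  refine inner_nonpos_of_forall_dist_le hw0 hw1 hu hle heq ha hb fun x hx y hy => ?_
  have hsum {G' : SimpleGraph ↥P} (x : ↥P) (hx : x ∈ s) (y : ↥P) (hy : y ∉ s) :=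
    SimpleGraph.sum_sum_ite_adj_of_eq_sup_edge (G := G') (fun x y : ↥P => dist (x : E) (y : E))
      (fun _ _ => dist_comm _ _) (ne_of_mem_of_not_mem hx hy) (hH x hx y hy).1
  have h := hmax _ (hH x hx y hy).2
  rw [hsum x hx y hy rfl, hsum a ha b hb hHG.symm] at h
  simp only [sub_sub_sub_cancel_right, ← dist_eq_norm]
  linarith
end
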